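/- arXiv:1310.4094 — 2 statements merged into one kernel-verified Lean document; each statement's English description precedes it below -/
import Mathlib

section
/- If f ∈ 𝔇_1 (the Dirichlet space of the bidisk) and there exists a probability measure μ of finite logarithmic energy supported on the radial boundary zero set 𝒵(f*) ⊂ 𝕋², then f is not cyclic in 𝔇_1. -/
open scoped ENNReal NNReal Classical
open Filter

/-- Weight `(k+1)^α` as an extended nonnegative real. -/
noncomputable def wt (α : ℝ) (k : ℕ) : ℝ≥0∞ := ((k : ℝ≥0∞) + 1) ^ α

/-- Squared norm of the Dirichlet-type space `𝔇_α` of the bidisk, at the level of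
Taylor coefficients `a k l`. -/
noncomputable def Dnorm2 (α : ℝ) (a : ℕ → ℕ → ℂ) : ℝ≥0∞ :=
  ∑' p : ℕ × ℕ, wt α p.1 * wt α p.2 * ((‖a p.1 p.2‖₊ : ℝ≥0∞)) ^ 2

/-- Squared norm of the one-variable Dirichlet-type space `D_α`. -/
noncomputable def dnorm2 (α : ℝ) (a : ℕ → ℂ) : ℝ≥0∞ :=
  ∑' k : ℕ, wt α k * ((‖a k‖₊ : ℝ≥0∞)) ^ 2

/-- Cauchy product (coefficients of the product of two power series in two variables). -/
noncomputable def conv2 (p a : ℕ → ℕ → ℂ) : ℕ → ℕ → ℂ := fun k l =>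
  ∑ i ∈ Finset.range (k + 1), ∑ j ∈ Finset.range (l + 1), p i j * a (k - i) (l - j)

/-- Cauchy product in one variable. -/
noncomputable def conv1 (p a : ℕ → ℂ) : ℕ → ℂ := fun k =>
  ∑ i ∈ Finset.range (k + 1), p i * a (k - i)

/-- Coefficients of the constant function `1` in two variables. -/
def one2 : ℕ → ℕ → ℂ := fun k l => if k = 0 ∧ l = 0 then 1 else 0

/-- Coefficients of the constant function `1` in one variable. -/
def one1 : ℕ → ℂ := fun k => if k = 0 then 1 else 0

/-- `p` is (the coefficient sequence of) a polynomial in `𝔓_n`. -/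
def IsPoly2 (n : ℕ) (p : ℕ → ℕ → ℂ) : Prop := ∀ k l, n < k ∨ n < l → p k l = 0

/-- `p` is a one-variable polynomial of degree at most `n`. -/
def IsPoly1 (n : ℕ) (p : ℕ → ℂ) : Prop := ∀ k, n < k → p k = 0

/-- Cyclicity of `a` in `𝔇_α`: some sequence of polynomials `p n` has `‖p n · f - 1‖_α → 0`. -/
def Cyclic2 (α : ℝ) (a : ℕ → ℕ → ℂ) : Prop :=
  ∃ p : ℕ → ℕ → ℕ → ℂ, (∀ n, ∃ m, IsPoly2 m (p n)) ∧
    Tendsto (fun n => Dnorm2 α (fun k l => conv2 (p n) a k l - one2 k l)) atTop (nhds 0)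

/-- Cyclicity of `a` in the one-variable space `D_α`. -/
def Cyclic1 (α : ℝ) (a : ℕ → ℂ) : Prop :=
  ∃ p : ℕ → ℕ → ℂ, (∀ n, ∃ m, IsPoly1 m (p n)) ∧
    Tendsto (fun n => dnorm2 α (fun k => conv1 (p n) a k - one1 k)) atTop (nhds 0)

/-- Squared distance `dist²_{𝔇_α}(1, f · 𝔓_n)`. -/
noncomputable def distP2 (α : ℝ) (n : ℕ) (a : ℕ → ℕ → ℂ) : ℝ≥0∞ :=
  ⨅ (p : ℕ → ℕ → ℂ) (_ : IsPoly2 n p), Dnorm2 α (fun k l => conv2 p a k l - one2 k l)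

/-- Fourier coefficient `μ̂(k,l)` of a measure on `ℝ × ℝ` (angles on the torus `𝕋²`). -/
noncomputable def muhat (μ : MeasureTheory.Measure (ℝ × ℝ)) (k l : ℤ) : ℂ :=
  ∫ θ, Complex.exp (-Complex.I * ((k : ℂ) * (θ.1 : ℂ) + (l : ℂ) * (θ.2 : ℂ))) ∂μ

/-- Logarithmic energy of a measure on `𝕋²`, in its Fourier representation. -/
noncomputable def energy (μ : MeasureTheory.Measure (ℝ × ℝ)) : ℝ≥0∞ :=
  1 + (∑' k : ℕ, ((‖muhat μ ((k : ℤ) + 1) 0‖₊ : ℝ≥0∞)) ^ 2 / ((k : ℝ≥0∞) + 1))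
    + (∑' l : ℕ, ((‖muhat μ 0 ((l : ℤ) + 1)‖₊ : ℝ≥0∞)) ^ 2 / ((l : ℝ≥0∞) + 1))
    + (1 / 2) * ∑' q : {k : ℤ // k ≠ 0} × ℕ,
        ((‖muhat μ q.1.1 ((q.2 : ℤ) + 1)‖₊ : ℝ≥0∞)) ^ 2 /
          ((q.1.1.natAbs : ℝ≥0∞) * ((q.2 : ℝ≥0∞) + 1))

/-- Squared Bergman `A²(𝔻²) = 𝔇_{-1}` norm of the Cauchy transform `C[μ]`, whose Taylor
coefficient at `z₁^k z₂^l` is `μ̂(-k,-l)`. -/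
noncomputable def bergNorm (μ : MeasureTheory.Measure (ℝ × ℝ)) : ℝ≥0∞ :=
  ∑' p : ℕ × ℕ, ((‖muhat μ (-(p.1 : ℤ)) (-(p.2 : ℤ))‖₊ : ℝ≥0∞)) ^ 2 /
    (((p.1 : ℝ≥0∞) + 1) * ((p.2 : ℝ≥0∞) + 1))

/-- The Cauchy transform `C[μ](z₁,z₂)`. -/
noncomputable def cauchy (μ : MeasureTheory.Measure (ℝ × ℝ)) (z1 z2 : ℂ) : ℂ :=
  ∫ θ, ((1 - Complex.exp (Complex.I * (θ.1 : ℂ)) * z1)⁻¹ *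
        (1 - Complex.exp (Complex.I * (θ.2 : ℂ)) * z2)⁻¹) ∂μ

open MeasureTheory

/-- Fourier coefficients of the logarithmic kernel `t ↦ 1 - log |1 - exp (-i t)|`. -/
noncomputable def logCoeff (k : ℤ) : ℝ := if k = 0 then 1 else 1 / (2 * k.natAbs)

/-- The logarithmic kernel, with Fourier coefficients damped by `ρ ^ |k|`. -/
noncomputable def logKernel (ρ t : ℝ) : ℝ :=
  1 - Real.log ‖1 - (ρ : ℂ) * Complex.exp (-Complex.I * t)‖

lemma logCoeff_pos (k : ℤ) : 0 < logCoeff k := by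
  unfold logCoeff
  split_ifs with h
  · exact one_pos
  · have : 0 < k.natAbs := Int.natAbs_pos.mpr h
    positivity

lemma logCoeff_le_one (k : ℤ) : logCoeff k ≤ 1 := by
  unfold logCoeff
  split_ifs with h
  · exact le_rfl
  · have : 1 ≤ k.natAbs := Int.natAbs_pos.mpr h
    have : (1 : ℝ) ≤ k.natAbs := by exact_mod_cast this
    rw [div_le_one (by positivity)]
    linarith

lemma logCoeff_neg (k : ℤ) : logCoeff (-k) = logCoeff k := by
  simp [logCoeff]

lemma inv_logCoeff_neg_natCast_le (k : ℕ) : (logCoeff (-(k : ℤ)))⁻¹ ≤ 2 * ((k : ℝ) + 1) := by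
  rw [logCoeff_neg]
  unfold logCoeff
  split_ifs with h
  · have : (0 : ℝ) ≤ k := k.cast_nonneg
    rw [inv_one]
    linarith
  · rw [one_div, inv_inv, Int.natAbs_natCast]
    linarith

lemma norm_ofReal_mul_exp_neg_I {ρ : ℝ} (hρ : 0 ≤ ρ) (t : ℝ) :
    ‖(ρ : ℂ) * Complex.exp (-Complex.I * t)‖ = ρ := by
  rw [norm_mul, Complex.norm_real, Real.norm_of_nonneg hρ, Complex.norm_exp]
  simp

lemma one_sub_ofReal_mul_exp_ne_zero {ρ : ℝ} (hρ : 0 ≤ ρ) (hρ1 : ρ < 1) (t : ℝ) :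
    1 - (ρ : ℂ) * Complex.exp (-Complex.I * t) ≠ 0 := by
  intro h
  have h1 := norm_ofReal_mul_exp_neg_I hρ t
  rw [← sub_eq_zero.mp h, norm_one] at h1
  exact hρ1.ne' h1

lemma logKernel_nonneg {ρ : ℝ} (hρ : 0 ≤ ρ) (hρ1 : ρ < 1) (t : ℝ) : 0 ≤ logKernel ρ t := by
  unfold logKernel
  have h1 : ‖1 - (ρ : ℂ) * Complex.exp (-Complex.I * t)‖ ≤ 2 := by
    refine (norm_sub_le _ _).trans ?_
    rw [norm_ofReal_mul_exp_neg_I hρ, norm_one]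
    linarith
  have h2 := Real.log_le_log (norm_pos_iff.mpr (one_sub_ofReal_mul_exp_ne_zero hρ hρ1 t)) h1
  have h3 := Real.log_two_lt_d9
  linarith

lemma continuous_logKernel {ρ : ℝ} (hρ : 0 ≤ ρ) (hρ1 : ρ < 1) : Continuous (logKernel ρ) := by
  unfold logKernel
  refine continuous_const.sub (Continuous.log (by fun_prop) fun t => ?_)
  exact norm_ne_zero_iff.mpr (one_sub_ofReal_mul_exp_ne_zero hρ hρ1 t)

lemma hasSum_logKernel {ρ : ℝ} (hρ : 0 ≤ ρ) (hρ1 : ρ < 1) (t : ℝ) :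
    HasSum (fun k : ℤ => ((logCoeff k * ρ ^ k.natAbs : ℝ) : ℂ) *
      Complex.exp (-Complex.I * (k * t))) (logKernel ρ t : ℂ) := by
  set z : ℂ := (ρ : ℂ) * Complex.exp (-Complex.I * t) with hz
  have hzn : ‖z‖ < 1 := by rw [hz, norm_ofReal_mul_exp_neg_I hρ]; exact hρ1
  have hlog := Complex.hasSum_taylorSeries_neg_log hzn
  have hpow : ∀ n : ℕ, z ^ n = (ρ : ℂ) ^ n * Complex.exp (-Complex.I * (n * t)) := by
    intro n
    rw [hz, mul_pow, ← Complex.exp_nat_mul]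
    ring_nf
  have hconj : ∀ n : ℕ, (starRingEnd ℂ) (z ^ n) =
      (ρ : ℂ) ^ n * Complex.exp (-Complex.I * (-n * t)) := by
    intro n
    rw [hpow, map_mul, map_pow, Complex.conj_ofReal, ← Complex.exp_conj]
    simp
  have hpos : HasSum (fun n : ℕ => ((logCoeff n * ρ ^ (n : ℤ).natAbs : ℝ) : ℂ) *
      Complex.exp (-Complex.I * ((n : ℤ) * t))) (1 + -Complex.log (1 - z) / 2) := by
    refine ((hasSum_ite_eq 0 (1 : ℂ)).add (hlog.div_const 2)).congr_fun ?_
    intro n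
    by_cases h : n = 0
    · simp [h, logCoeff]
    · simp [h, logCoeff, hpow]
      field_simp
  have hneg : HasSum (fun n : ℕ =>
      ((logCoeff (-((n : ℤ) + 1)) * ρ ^ (-((n : ℤ) + 1)).natAbs : ℝ) : ℂ) *
      Complex.exp (-Complex.I * ((-((n : ℤ) + 1) : ℤ) * t)))
      ((starRingEnd ℂ) (-Complex.log (1 - z)) / 2) := by
    have h1 := (Complex.hasSum_conj'.mpr ((hasSum_nat_add_iff' 1).mpr hlog)).div_const 2
    simp only [Finset.range_one, Finset.sum_singleton, Nat.cast_zero, div_zero, sub_zero] at h1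
    refine h1.congr_fun ?_
    intro n
    have h2 : (-((n : ℤ) + 1)).natAbs = n + 1 := by omega
    have h3 : -((n : ℤ) + 1) ≠ 0 := by omega
    rw [map_div₀, hconj, logCoeff, if_neg h3, h2]
    push_cast
    simp only [map_add, map_natCast, map_one]
    field_simp
  have h := HasSum.of_nat_of_neg_add_one (f := fun k : ℤ => ((logCoeff k * ρ ^ k.natAbs : ℝ) : ℂ) *
      Complex.exp (-Complex.I * (k * t))) hpos hneg
  convert h using 1
  rw [add_assoc, ← add_div, Complex.add_conj, Complex.neg_re, Complex.log_re, logKernel]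
  push_cast
  ring

/-- The character `θ ↦ exp (-i (q₁ θ₁ + q₂ θ₂))` of the torus. -/
noncomputable def torusChar (q : ℤ × ℤ) (x : ℝ × ℝ) : ℂ :=
  Complex.exp (-Complex.I * ((q.1 : ℂ) * (x.1 : ℂ) + (q.2 : ℂ) * (x.2 : ℂ)))

lemma norm_torusChar (q : ℤ × ℤ) (x : ℝ × ℝ) : ‖torusChar q x‖ = 1 := by
  rw [torusChar, Complex.norm_exp]
  simp

lemma continuous_torusChar (q : ℤ × ℤ) : Continuous (torusChar q) := by
  unfold torusChar
  fun_prop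

lemma torusChar_sub (q : ℤ × ℤ) (x y : ℝ × ℝ) :
    torusChar q (x - y) = torusChar q x * (starRingEnd ℂ) (torusChar q y) := by
  unfold torusChar
  rw [← Complex.exp_conj, ← Complex.exp_add]
  congr 1
  simp
  ring

/-- Fourier coefficients of the product of two damped logarithmic kernels. -/
noncomputable def dampedCoeff (ρ : ℝ) (q : ℤ × ℤ) : ℝ :=
  logCoeff q.1 * ρ ^ q.1.natAbs * (logCoeff q.2 * ρ ^ q.2.natAbs)

/-- Fourier coefficients of the product of two logarithmic kernels. -/
noncomputable def energyCoeff (q : ℤ × ℤ) : ℝ := logCoeff q.1 * logCoeff q.2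

lemma energyCoeff_pos (q : ℤ × ℤ) : 0 < energyCoeff q :=
  mul_pos (logCoeff_pos _) (logCoeff_pos _)

lemma dampedCoeff_eq (ρ : ℝ) (q : ℤ × ℤ) :
    dampedCoeff ρ q = energyCoeff q * (ρ ^ q.1.natAbs * ρ ^ q.2.natAbs) := by
  unfold dampedCoeff energyCoeff
  ring

lemma dampedCoeff_nonneg {ρ : ℝ} (hρ : 0 ≤ ρ) (q : ℤ × ℤ) : 0 ≤ dampedCoeff ρ q := by
  rw [dampedCoeff_eq]
  have := energyCoeff_pos q
  positivity

lemma dampedCoeff_le {ρ : ℝ} (hρ : 0 ≤ ρ) (hρ1 : ρ < 1) (q : ℤ × ℤ) :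
    dampedCoeff ρ q ≤ energyCoeff q := by
  rw [dampedCoeff_eq]
  refine mul_le_of_le_one_right (energyCoeff_pos q).le ?_
  exact mul_le_one₀ (pow_le_one₀ hρ hρ1.le) (by positivity) (pow_le_one₀ hρ hρ1.le)

lemma summable_dampedCoeff {ρ : ℝ} (hρ : 0 ≤ ρ) (hρ1 : ρ < 1) :
    Summable (dampedCoeff ρ) := by
  have h : Summable fun k : ℤ => ‖logCoeff k * ρ ^ k.natAbs‖ := by
    have h0 := (hasSum_logKernel hρ hρ1 0).summable.norm
    simpa using h0
  exact summable_mul_of_summable_norm h h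

lemma hasSum_logKernel_mul_logKernel {ρ : ℝ} (hρ : 0 ≤ ρ) (hρ1 : ρ < 1) (x : ℝ × ℝ) :
    HasSum (fun q : ℤ × ℤ => (dampedCoeff ρ q : ℂ) * torusChar q x)
      ((logKernel ρ x.1 * logKernel ρ x.2 : ℝ) : ℂ) := by
  set g : ℝ → ℤ → ℂ := fun t k => ((logCoeff k * ρ ^ k.natAbs : ℝ) : ℂ) *
    Complex.exp (-Complex.I * (k * t)) with hg
  have h1 : HasSum (g x.1) (logKernel ρ x.1 : ℂ) := hasSum_logKernel hρ hρ1 x.1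
  have h2 : HasSum (g x.2) (logKernel ρ x.2 : ℂ) := hasSum_logKernel hρ hρ1 x.2
  have h := h1.mul h2 (summable_mul_of_summable_norm h1.summable.norm h2.summable.norm)
  rw [Complex.ofReal_mul]
  refine h.congr_fun fun q => ?_
  simp only [hg]
  rw [dampedCoeff, torusChar, mul_add, Complex.exp_add, Complex.ofReal_mul _ (_ * _)]
  ring

lemma hasSum_dampedCoeff_mul_norm_sq (μ : Measure (ℝ × ℝ)) [IsProbabilityMeasure μ]
    {ρ : ℝ} (hρ : 0 ≤ ρ) (hρ1 : ρ < 1) {φ : ℝ × ℝ → ℂ} (hφ : AEStronglyMeasurable φ μ)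
    (hφ1 : ∀ x, ‖φ x‖ ≤ 1) :
    HasSum (fun q : ℤ × ℤ => ((dampedCoeff ρ q * ‖∫ x, φ x * torusChar q x ∂μ‖ ^ 2 : ℝ) : ℂ))
      (∫ z, φ z.1 * (starRingEnd ℂ) (φ z.2) *
        ((logKernel ρ (z.1 - z.2).1 * logKernel ρ (z.1 - z.2).2 : ℝ) : ℂ) ∂μ.prod μ) := by
  set g : ℤ × ℤ → ℝ × ℝ → ℂ := fun q x => φ x * torusChar q x with hg
  have hgm : ∀ q, AEStronglyMeasurable (g q) μ := fun q =>
    hφ.mul (continuous_torusChar q).aestronglyMeasurable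
  have hgn : ∀ q x, ‖g q x‖ ≤ 1 := fun q x => by
    rw [hg, norm_mul, norm_torusChar, mul_one]
    exact hφ1 x
  have hgi : ∀ q, Integrable (g q) μ := fun q =>
    Integrable.of_bound (hgm q) 1 (ae_of_all _ (hgn q))
  have hgc : ∀ q, Integrable (fun x => (starRingEnd ℂ) (g q x)) μ := fun q =>
    Integrable.of_bound (Complex.continuous_conj.comp_aestronglyMeasurable (hgm q)) 1
      (ae_of_all _ fun x => by rw [RCLike.norm_conj]; exact hgn q x)
  set F : ℤ × ℤ → (ℝ × ℝ) × (ℝ × ℝ) → ℂ := fun q z =>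
    (dampedCoeff ρ q : ℂ) * (g q z.1 * (starRingEnd ℂ) (g q z.2)) with hF
  have hFi : ∀ q, Integrable (F q) (μ.prod μ) := fun q =>
    ((hgi q).mul_prod (hgc q)).const_mul _
  have hFn : ∀ q z, ‖F q z‖ ≤ dampedCoeff ρ q := fun q z => by
    rw [hF, norm_mul, norm_mul, RCLike.norm_conj, Complex.norm_real,
      Real.norm_of_nonneg (dampedCoeff_nonneg hρ q)]
    exact mul_le_of_le_one_right (dampedCoeff_nonneg hρ q)
      (mul_le_one₀ (hgn q _) (norm_nonneg _) (hgn q _))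
  have hFs : Summable fun q => ∫ z, ‖F q z‖ ∂μ.prod μ := by
    refine Summable.of_nonneg_of_le (fun q => integral_nonneg fun z => norm_nonneg _)
      (fun q => ?_) (summable_dampedCoeff hρ hρ1)
    refine (integral_mono (hFi q).norm (integrable_const (dampedCoeff ρ q)) (hFn q)).trans ?_
    simp
  have h := hasSum_integral_of_summable_integral_norm hFi hFs
  have hint : ∫ z, ∑' q, F q z ∂μ.prod μ = ∫ z, φ z.1 * (starRingEnd ℂ) (φ z.2) *
      ((logKernel ρ (z.1 - z.2).1 * logKernel ρ (z.1 - z.2).2 : ℝ) : ℂ) ∂μ.prod μ := by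
    refine integral_congr_ae (ae_of_all _ fun z => HasSum.tsum_eq ?_)
    refine ((hasSum_logKernel_mul_logKernel hρ hρ1 (z.1 - z.2)).mul_left
      (φ z.1 * (starRingEnd ℂ) (φ z.2))).congr_fun fun q => ?_
    simp only [hF, hg, torusChar_sub, map_mul]
    ring
  rw [hint] at h
  refine h.congr_fun fun q => ?_
  simp only [hF]
  rw [integral_const_mul, integral_prod_mul (g q) fun y => (starRingEnd ℂ) (g q y),
    integral_conj, Complex.mul_conj, Complex.normSq_eq_norm_sq]
  push_cast
  rfl

lemma sum_energyCoeff_mul_norm_sq_le (μ : Measure (ℝ × ℝ)) [IsProbabilityMeasure μ]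
    (hμ : Summable fun q : ℤ × ℤ => energyCoeff q * ‖muhat μ q.1 q.2‖ ^ 2)
    {φ : ℝ × ℝ → ℂ} (hφ : AEStronglyMeasurable φ μ) (hφ1 : ∀ x, ‖φ x‖ ≤ 1)
    (s : Finset (ℤ × ℤ)) :
    ∑ q ∈ s, energyCoeff q * ‖∫ x, φ x * torusChar q x ∂μ‖ ^ 2 ≤
      ∑' q : ℤ × ℤ, energyCoeff q * ‖muhat μ q.1 q.2‖ ^ 2 := by
  have key : ∀ ρ : ℝ, 0 ≤ ρ → ρ < 1 →
      ∑ q ∈ s, dampedCoeff ρ q * ‖∫ x, φ x * torusChar q x ∂μ‖ ^ 2 ≤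
      ∑' q : ℤ × ℤ, energyCoeff q * ‖muhat μ q.1 q.2‖ ^ 2 := by
    intro ρ hρ hρ1
    have h1 := hasSum_dampedCoeff_mul_norm_sq μ hρ hρ1 hφ hφ1
    have h2 := hasSum_dampedCoeff_mul_norm_sq μ hρ hρ1 (φ := fun _ => 1)
      aestronglyMeasurable_const (by simp)
    simp only [one_mul, map_one] at h2
    rw [integral_complex_ofReal] at h2
    have h2' := Complex.hasSum_ofReal.mp h2
    have h1' := Complex.hasSum_re h1
    simp only [Complex.ofReal_re] at h1'
    have hcont : Continuous fun z : (ℝ × ℝ) × (ℝ × ℝ) =>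
        logKernel ρ (z.1 - z.2).1 * logKernel ρ (z.1 - z.2).2 :=
      ((continuous_logKernel hρ hρ1).comp (by fun_prop)).mul
        ((continuous_logKernel hρ hρ1).comp (by fun_prop))
    have hnn : ∀ z : (ℝ × ℝ) × (ℝ × ℝ),
        0 ≤ logKernel ρ (z.1 - z.2).1 * logKernel ρ (z.1 - z.2).2 := fun z =>
      mul_nonneg (logKernel_nonneg hρ hρ1 _) (logKernel_nonneg hρ hρ1 _)
    have hint : Integrable (fun z : (ℝ × ℝ) × (ℝ × ℝ) =>
        logKernel ρ (z.1 - z.2).1 * logKernel ρ (z.1 - z.2).2) (μ.prod μ) := by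
      refine Integrable.of_bound hcont.aestronglyMeasurable (∑' q, dampedCoeff ρ q)
        (ae_of_all _ fun z => ?_)
      rw [← Complex.norm_real]
      refine (hasSum_logKernel_mul_logKernel hρ hρ1 (z.1 - z.2)).norm_le_of_bounded
        (summable_dampedCoeff hρ hρ1).hasSum fun q => ?_
      rw [norm_mul, norm_torusChar, mul_one, Complex.norm_real,
        Real.norm_of_nonneg (dampedCoeff_nonneg hρ q)]
    calc _ ≤ _ := sum_le_hasSum s (fun q _ => mul_nonneg (dampedCoeff_nonneg hρ q) (sq_nonneg _)) h1'
      _ ≤ _ := Complex.re_le_norm _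
      _ ≤ _ := norm_integral_le_integral_norm _
      _ ≤ ∫ z : (ℝ × ℝ) × (ℝ × ℝ),
          logKernel ρ (z.1 - z.2).1 * logKernel ρ (z.1 - z.2).2 ∂μ.prod μ := by
        refine integral_mono_of_nonneg (ae_of_all _ fun z => norm_nonneg _) hint
          (ae_of_all _ fun z => ?_)
        simp only [norm_mul, RCLike.norm_conj]
        rw [Complex.norm_real, Real.norm_of_nonneg (hnn z)]
        exact mul_le_of_le_one_left (hnn z) (mul_le_one₀ (hφ1 _) (norm_nonneg _) (hφ1 _))
      _ = ∑' q : ℤ × ℤ, dampedCoeff ρ q * ‖muhat μ q.1 q.2‖ ^ 2 := h2'.tsum_eq.symm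
      _ ≤ _ := h2'.summable.tsum_le_tsum
        (fun q => mul_le_mul_of_nonneg_right (dampedCoeff_le hρ hρ1 q) (sq_nonneg _)) hμ
  have hlim : Tendsto (fun ρ : ℝ => ∑ q ∈ s, dampedCoeff ρ q * ‖∫ x, φ x * torusChar q x ∂μ‖ ^ 2)
      (nhdsWithin 1 (Set.Iio 1))
      (nhds (∑ q ∈ s, dampedCoeff 1 q * ‖∫ x, φ x * torusChar q x ∂μ‖ ^ 2)) := by
    have hc : Continuous fun ρ : ℝ =>
        ∑ q ∈ s, dampedCoeff ρ q * ‖∫ x, φ x * torusChar q x ∂μ‖ ^ 2 := by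
      unfold dampedCoeff
      fun_prop
    exact (hc.tendsto 1).mono_left nhdsWithin_le_nhds
  have h1 : ∀ q, dampedCoeff 1 q = energyCoeff q := fun q => by simp [dampedCoeff_eq]
  simp only [h1] at hlim
  refine le_of_tendsto hlim ?_
  filter_upwards [Ioo_mem_nhdsLT (zero_lt_one' ℝ)] with ρ hρ
  exact key ρ hρ.1.le hρ.2

lemma tsum_int_ne_top {f : ℤ → ℝ≥0∞} (hf : ∀ k, f (-k) = f k) (h0 : f 0 ≠ ⊤)
    (h : ∑' k : ℕ, f ((k : ℤ) + 1) ≠ ⊤) : ∑' k, f k ≠ ⊤ := by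
  rw [tsum_of_nat_of_neg_add_one ENNReal.summable ENNReal.summable,
    tsum_eq_zero_add' ENNReal.summable]
  simp only [hf, Nat.cast_add, Nat.cast_one, Nat.cast_zero]
  exact ENNReal.add_ne_top.mpr ⟨ENNReal.add_ne_top.mpr ⟨h0, h⟩, h⟩

lemma tsum_int_prod_ne_top {f : ℤ → ℤ → ℝ≥0∞} (hf : ∀ k l, f (-k) (-l) = f k l)
    (h00 : f 0 0 ≠ ⊤) (h1 : ∑' k : ℕ, f ((k : ℤ) + 1) 0 ≠ ⊤)
    (h2 : ∑' l : ℕ, f 0 ((l : ℤ) + 1) ≠ ⊤)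
    (h3 : ∑' q : {k : ℤ // k ≠ 0} × ℕ, f q.1.1 ((q.2 : ℤ) + 1) ≠ ⊤) :
    ∑' q : ℤ × ℤ, f q.1 q.2 ≠ ⊤ := by
  rw [ENNReal.tsum_prod, ENNReal.tsum_comm]
  refine tsum_int_ne_top (fun l => ?_) ?_ ?_
  · rw [← (Equiv.neg ℤ).tsum_eq]
    simp only [Equiv.neg_apply, hf]
  · refine tsum_int_ne_top (fun k => ?_) h00 h1
    simpa using hf k 0
  · rw [ENNReal.tsum_prod (f := fun (k : {k : ℤ // k ≠ 0}) (l : ℕ) => f k ((l : ℤ) + 1))] at h3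
    rw [ENNReal.tsum_comm, ← Summable.tsum_add_tsum_compl (s := {(0 : ℤ)})
      ENNReal.summable ENNReal.summable, tsum_singleton (0 : ℤ) fun k => ∑' l : ℕ, f k ((l : ℤ) + 1)]
    exact ENNReal.add_ne_top.mpr ⟨h2, h3⟩

lemma ofReal_logCoeff_le {k : ℤ} (hk : k ≠ 0) :
    ENNReal.ofReal (logCoeff k) ≤ (k.natAbs : ℝ≥0∞)⁻¹ := by
  have h : (0 : ℝ) < k.natAbs := by exact_mod_cast Int.natAbs_pos.mpr hk
  rw [← ENNReal.ofReal_natCast, ← ENNReal.ofReal_inv_of_pos h, logCoeff, if_neg hk, one_div]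
  gcongr
  linarith

lemma norm_muhat_neg (μ : Measure (ℝ × ℝ)) (k l : ℤ) :
    ‖muhat μ (-k) (-l)‖₊ = ‖muhat μ k l‖₊ := by
  have h : muhat μ (-k) (-l) = (starRingEnd ℂ) (muhat μ k l) := by
    unfold muhat
    rw [← integral_conj]
    congr 1
    ext θ
    rw [← Complex.exp_conj]
    congr 1
    simp
    ring
  rw [h, RCLike.nnnorm_conj]

lemma summable_energyCoeff_mul_norm_sq {μ : Measure (ℝ × ℝ)} (hE : energy μ ≠ ⊤) :
    Summable fun q : ℤ × ℤ => energyCoeff q * ‖muhat μ q.1 q.2‖ ^ 2 := by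
  unfold energy at hE
  obtain ⟨hE, hE3⟩ := ENNReal.add_ne_top.mp hE
  obtain ⟨hE, hE2⟩ := ENNReal.add_ne_top.mp hE
  obtain ⟨-, hE1⟩ := ENNReal.add_ne_top.mp hE
  have hE3' : ∑' q : {k : ℤ // k ≠ 0} × ℕ, ((‖muhat μ q.1.1 ((q.2 : ℤ) + 1)‖₊ : ℝ≥0∞)) ^ 2 /
      ((q.1.1.natAbs : ℝ≥0∞) * ((q.2 : ℝ≥0∞) + 1)) ≠ ⊤ := by
    intro h
    rw [h] at hE3
    simp at hE3
  have hsucc : ∀ k : ℕ, ENNReal.ofReal (logCoeff ((k : ℤ) + 1)) ≤ ((k : ℝ≥0∞) + 1)⁻¹ := by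
    intro k
    have h := ofReal_logCoeff_le (k := (k : ℤ) + 1) (by omega)
    have h2 : ((k : ℤ) + 1).natAbs = k + 1 := by omega
    rwa [h2, Nat.cast_add, Nat.cast_one] at h
  have h0 : ENNReal.ofReal (logCoeff 0) = 1 := by simp [logCoeff]
  have key := tsum_int_prod_ne_top (f := fun k l =>
    ENNReal.ofReal (logCoeff k) * ENNReal.ofReal (logCoeff l) * (‖muhat μ k l‖₊ : ℝ≥0∞) ^ 2)
    (fun k l => by rw [logCoeff_neg, logCoeff_neg, norm_muhat_neg]) (by finiteness)
    (ne_top_of_le_ne_top hE1 (ENNReal.tsum_le_tsum fun k => by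
      rw [h0, mul_one, mul_comm, div_eq_mul_inv]
      gcongr
      exact hsucc k))
    (ne_top_of_le_ne_top hE2 (ENNReal.tsum_le_tsum fun l => by
      rw [h0, one_mul, mul_comm, div_eq_mul_inv]
      gcongr
      exact hsucc l))
    (ne_top_of_le_ne_top hE3' (ENNReal.tsum_le_tsum fun q => by
      rw [mul_comm, div_eq_mul_inv, ENNReal.mul_inv (by simp) (by simp)]
      gcongr
      · exact ofReal_logCoeff_le q.1.2
      · exact hsucc q.2))
  refine (ENNReal.summable_toReal key).congr fun q => ?_
  simp [energyCoeff, ENNReal.toReal_mul, (logCoeff_pos _).le]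

lemma sq_integral_norm_tsum_le {μ : Measure (ℝ × ℝ)} [IsProbabilityMeasure μ]
    (hμ : Summable fun q : ℤ × ℤ => energyCoeff q * ‖muhat μ q.1 q.2‖ ^ 2)
    {b : ℕ × ℕ → ℂ} (hb : Summable fun p => ‖b p‖) {D : ℝ}
    (hD : ∀ s : Finset (ℕ × ℕ), ∑ p ∈ s, ((p.1 : ℝ) + 1) * ((p.2 : ℝ) + 1) * ‖b p‖ ^ 2 ≤ D) :
    (∫ x, ‖∑' p : ℕ × ℕ, b p * torusChar (-(p.1 : ℤ), -(p.2 : ℤ)) x‖ ∂μ) ^ 2 ≤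
      4 * D * ∑' q : ℤ × ℤ, energyCoeff q * ‖muhat μ q.1 q.2‖ ^ 2 := by
  set E := ∑' q : ℤ × ℤ, energyCoeff q * ‖muhat μ q.1 q.2‖ ^ 2
  set ι : ℕ × ℕ → ℤ × ℤ := fun p => (-(p.1 : ℤ), -(p.2 : ℤ)) with hι
  have hιinj : Function.Injective ι := by
    intro p p' h
    simp only [hι, Prod.mk.injEq] at h
    ext <;> omega
  set F : ℝ × ℝ → ℂ := fun x => ∑' p : ℕ × ℕ, b p * torusChar (ι p) x with hF
  have hbn : ∀ p x, ‖b p * torusChar (ι p) x‖ = ‖b p‖ := fun p x => by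
    rw [norm_mul, norm_torusChar, mul_one]
  have hFc : Continuous F := continuous_tsum
    (fun p => continuous_const.mul (continuous_torusChar _)) hb fun p x => (hbn p x).le
  set φ : ℝ × ℝ → ℂ := fun x => (starRingEnd ℂ) (F x) / ‖F x‖ with hφ
  have hφm : Measurable φ := by
    have h1 : Measurable F := hFc.measurable
    have h2 : Measurable fun x => (starRingEnd ℂ) (F x) :=
      (Complex.continuous_conj.comp hFc).measurable
    exact h2.div (Complex.measurable_ofReal.comp h1.norm)
  have hφ1 : ∀ x, ‖φ x‖ ≤ 1 := fun x => by
    rw [hφ, norm_div, RCLike.norm_conj, Complex.norm_real, norm_norm]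
    exact div_self_le_one _
  have hφF : ∀ x, φ x * F x = ‖F x‖ := fun x => by
    by_cases h : F x = 0
    · simp [h]
    · have h' : (‖F x‖ : ℂ) ≠ 0 := by simpa using h
      rw [hφ, div_mul_eq_mul_div, mul_comm, Complex.mul_conj, Complex.normSq_eq_norm_sq,
        Complex.ofReal_pow, sq, mul_div_assoc, div_self h', mul_one]
  have hint : ∀ p, Integrable (fun x => b p * (φ x * torusChar (ι p) x)) μ := fun p =>
    (Integrable.of_bound (hφm.aestronglyMeasurable.mul
      (continuous_torusChar _).aestronglyMeasurable) 1 (ae_of_all _ fun x => by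
        rw [Pi.mul_apply, norm_mul, norm_torusChar, mul_one]; exact hφ1 x)).const_mul _
  have hle : ∀ p x, ‖b p * (φ x * torusChar (ι p) x)‖ ≤ ‖b p‖ := fun p x => by
    rw [norm_mul, norm_mul, norm_torusChar, mul_one]
    exact mul_le_of_le_one_right (norm_nonneg _) (hφ1 x)
  have hsum := hasSum_integral_of_summable_integral_norm hint
    (Summable.of_nonneg_of_le (fun p => integral_nonneg fun x => norm_nonneg _) (fun p => by
      refine (integral_mono (hint p).norm (integrable_const ‖b p‖) (hle p)).trans ?_
      simp) hb)
  have htot : ∫ x, ∑' p, b p * (φ x * torusChar (ι p) x) ∂μ = ((∫ x, ‖F x‖ ∂μ : ℝ) : ℂ) := by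
    rw [← integral_complex_ofReal]
    refine integral_congr_ae (ae_of_all _ fun x => ?_)
    simp only
    rw [← hφF, hF, ← tsum_mul_left]
    exact tsum_congr fun p => by ring
  rw [htot] at hsum
  have hlim := ((hsum.norm).pow 2)
  rw [Complex.norm_real, Real.norm_eq_abs, sq_abs] at hlim
  refine le_of_tendsto hlim (Eventually.of_forall fun s => ?_)
  have hD0 : 0 ≤ D := by simpa using hD ∅
  have hEs : ∑ p ∈ s, energyCoeff (ι p) * ‖∫ x, φ x * torusChar (ι p) x ∂μ‖ ^ 2 ≤ E := by
    have h := sum_energyCoeff_mul_norm_sq_le μ hμ hφm.aestronglyMeasurable hφ1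
      (s.map ⟨ι, hιinj⟩)
    rwa [Finset.sum_map] at h
  have hDs : ∑ p ∈ s, ‖b p‖ ^ 2 * (energyCoeff (ι p))⁻¹ ≤ 4 * D := by
    refine le_trans ?_ (mul_le_mul_of_nonneg_left (hD s) (by norm_num))
    rw [Finset.mul_sum]
    refine Finset.sum_le_sum fun p _ => ?_
    have h1 := inv_logCoeff_neg_natCast_le p.1
    have h2 := inv_logCoeff_neg_natCast_le p.2
    have h3 : (energyCoeff (ι p))⁻¹ ≤ 2 * ((p.1 : ℝ) + 1) * (2 * ((p.2 : ℝ) + 1)) := by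
      rw [energyCoeff, mul_inv]
      exact mul_le_mul h1 h2 (inv_nonneg.mpr (logCoeff_pos _).le) (by positivity)
    nlinarith [mul_le_mul_of_nonneg_left h3 (sq_nonneg ‖b p‖)]
  calc ‖∑ p ∈ s, ∫ x, b p * (φ x * torusChar (ι p) x) ∂μ‖ ^ 2
      ≤ (∑ p ∈ s, ‖b p‖ * ‖∫ x, φ x * torusChar (ι p) x ∂μ‖) ^ 2 := by
        gcongr
        refine norm_sum_le_of_le s fun p _ => ?_
        rw [integral_const_mul, norm_mul]
    _ ≤ (∑ p ∈ s, ‖b p‖ ^ 2 * (energyCoeff (ι p))⁻¹) *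
        ∑ p ∈ s, energyCoeff (ι p) * ‖∫ x, φ x * torusChar (ι p) x ∂μ‖ ^ 2 := by
        refine Finset.sum_sq_le_sum_mul_sum_of_sq_le_mul s (fun p _ => ?_) (fun p _ => ?_)
          fun p _ => le_of_eq ?_
        · have := energyCoeff_pos (ι p)
          positivity
        · have := energyCoeff_pos (ι p)
          positivity
        · have := (energyCoeff_pos (ι p)).ne'
          field_simp
    _ ≤ 4 * D * E := mul_le_mul hDs hEs
        (Finset.sum_nonneg fun p _ => mul_nonneg (energyCoeff_pos _).le (sq_nonneg _))
        (by positivity)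

lemma hasSum_conv2_mul_pow {p a : ℕ → ℕ → ℂ} {m : ℕ} (hp : IsPoly2 m p) {x y : ℂ}
    (ha : Summable fun q : ℕ × ℕ => a q.1 q.2 * x ^ q.1 * y ^ q.2) :
    HasSum (fun q : ℕ × ℕ => conv2 p a q.1 q.2 * x ^ q.1 * y ^ q.2)
      ((∑ i ∈ Finset.range (m + 1), ∑ j ∈ Finset.range (m + 1), p i j * x ^ i * y ^ j) *
        ∑' q : ℕ × ℕ, a q.1 q.2 * x ^ q.1 * y ^ q.2) := by
  set S := ∑' q : ℕ × ℕ, a q.1 q.2 * x ^ q.1 * y ^ q.2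
  set g : ℕ → ℕ → ℕ × ℕ → ℂ := fun i j q =>
    if i ≤ q.1 ∧ j ≤ q.2 then p i j * a (q.1 - i) (q.2 - j) else 0 with hg
  have hshift : ∀ i j : ℕ, HasSum (fun q : ℕ × ℕ => g i j q * x ^ q.1 * y ^ q.2)
      (p i j * x ^ i * y ^ j * S) := by
    intro i j
    have hinj : Function.Injective fun q : ℕ × ℕ => (q.1 + i, q.2 + j) := by
      intro q q' h
      simp only [Prod.mk.injEq] at h
      ext <;> omega
    refine (hinj.hasSum_iff fun q hq => ?_).mp
      ((ha.hasSum.mul_left (p i j * x ^ i * y ^ j)).congr_fun fun q => ?_)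
    · have : ¬ (i ≤ q.1 ∧ j ≤ q.2) := fun h => hq
        ⟨(q.1 - i, q.2 - j), by ext <;> simp <;> omega⟩
      simp [hg, this]
    · simp only [hg, Function.comp_apply, le_add_iff_nonneg_left, zero_le, and_self, if_true,
        Nat.add_sub_cancel, pow_add]
      ring
  rw [Finset.sum_mul]
  simp only [Finset.sum_mul]
  refine (hasSum_sum fun i _ => hasSum_sum fun j _ => hshift i j).congr_fun fun q => ?_
  have hconv : conv2 p a q.1 q.2 =
      ∑ i ∈ Finset.range (m + 1), ∑ j ∈ Finset.range (m + 1), g i j q := by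
    have h1 : conv2 p a q.1 q.2 = ∑ i ∈ Finset.range (m + q.1 + 1),
        ∑ j ∈ Finset.range (m + q.2 + 1), g i j q := by
      unfold conv2
      rw [← Finset.sum_subset (Finset.range_mono (by omega : q.1 + 1 ≤ m + q.1 + 1))]
      · refine Finset.sum_congr rfl fun i hi => ?_
        rw [← Finset.sum_subset (Finset.range_mono (by omega : q.2 + 1 ≤ m + q.2 + 1))]
        · refine Finset.sum_congr rfl fun j hj => ?_
          rw [Finset.mem_range] at hi hj
          simp only [hg]
          rw [if_pos ⟨by omega, by omega⟩]
        · intro j _ hj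
          rw [Finset.mem_range] at hj
          exact if_neg fun h => hj (by omega)
      · intro i _ hi
        rw [Finset.mem_range] at hi
        exact Finset.sum_eq_zero fun j _ => if_neg fun h => hi (by omega)
    rw [h1]
    rw [← Finset.sum_subset (Finset.range_mono (by omega : m + 1 ≤ m + q.1 + 1))]
    · refine Finset.sum_congr rfl fun i _ => ?_
      rw [← Finset.sum_subset (Finset.range_mono (by omega : m + 1 ≤ m + q.2 + 1))]
      intro j _ hj
      rw [Finset.mem_range] at hj
      simp only [hg]
      rw [hp i j (Or.inr (by omega))]
      simp
    · intro i _ hi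
      rw [Finset.mem_range] at hi
      refine Finset.sum_eq_zero fun j _ => ?_
      simp only [hg]
      rw [hp i j (Or.inl (by omega))]
      simp
  rw [hconv, Finset.sum_mul, Finset.sum_mul]
  simp only [Finset.sum_mul]

lemma hasSum_one2_mul_pow (x y : ℂ) :
    HasSum (fun q : ℕ × ℕ => one2 q.1 q.2 * x ^ q.1 * y ^ q.2) 1 := by
  refine (hasSum_ite_eq (0 : ℕ × ℕ) (1 : ℂ)).congr_fun fun q => ?_
  by_cases h : q = 0
  · simp [h, one2]
  · have : ¬ (q.1 = 0 ∧ q.2 = 0) := fun h' => h (Prod.ext h'.1 h'.2)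
    simp [h, this, one2]

lemma sum_weight_mul_norm_sq_le {a : ℕ → ℕ → ℂ} (ha : Dnorm2 1 a ≠ ⊤) (s : Finset (ℕ × ℕ)) :
    ∑ p ∈ s, ((p.1 : ℝ) + 1) * ((p.2 : ℝ) + 1) * ‖a p.1 p.2‖ ^ 2 ≤ (Dnorm2 1 a).toReal := by
  have h := ENNReal.toReal_mono ha (ENNReal.sum_le_tsum (f := fun p : ℕ × ℕ =>
    wt 1 p.1 * wt 1 p.2 * ((‖a p.1 p.2‖₊ : ℝ≥0∞)) ^ 2) s)
  rw [ENNReal.toReal_sum fun p _ => by simp [wt]; finiteness] at h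
  refine le_of_eq_of_le (Finset.sum_congr rfl fun p _ => ?_) h
  simp [wt, ENNReal.toReal_add]

lemma summable_norm_mul_pow {a : ℕ → ℕ → ℂ} (ha : Dnorm2 1 a ≠ ⊤) {r : ℝ} (hr : 0 ≤ r)
    (hr1 : r < 1) : Summable fun p : ℕ × ℕ => ‖a p.1 p.2‖ * r ^ p.1 * r ^ p.2 := by
  have hgeom : Summable fun p : ℕ × ℕ => r ^ p.1 * r ^ p.2 :=
    summable_mul_of_summable_norm (f := fun k : ℕ => r ^ k) (g := fun k : ℕ => r ^ k)
      (summable_geometric_of_lt_one hr hr1).norm (summable_geometric_of_lt_one hr hr1).norm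
  refine Summable.of_nonneg_of_le (fun p => by positivity) (fun p => ?_)
    (hgeom.mul_left (1 + (Dnorm2 1 a).toReal))
  rw [mul_assoc]
  refine mul_le_mul_of_nonneg_right ?_ (by positivity)
  have h := sum_weight_mul_norm_sq_le ha {p}
  rw [Finset.sum_singleton] at h
  have h1 : ‖a p.1 p.2‖ ^ 2 ≤ ((p.1 : ℝ) + 1) * ((p.2 : ℝ) + 1) * ‖a p.1 p.2‖ ^ 2 := by
    refine le_mul_of_one_le_left (sq_nonneg _) (one_le_mul_of_one_le_of_one_le ?_ ?_) <;> simp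
  nlinarith [sq_nonneg (‖a p.1 p.2‖ - 1)]

lemma ofReal_mul_exp_pow_mul_pow (r : ℝ) (θ : ℝ × ℝ) (p : ℕ × ℕ) :
    ((r : ℂ) * Complex.exp (Complex.I * (θ.1 : ℂ))) ^ p.1 *
      ((r : ℂ) * Complex.exp (Complex.I * (θ.2 : ℂ))) ^ p.2 =
    (r : ℂ) ^ p.1 * (r : ℂ) ^ p.2 * torusChar (-(p.1 : ℤ), -(p.2 : ℤ)) θ := by
  rw [mul_pow, mul_pow, ← Complex.exp_nat_mul, ← Complex.exp_nat_mul, mul_mul_mul_comm,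
    ← Complex.exp_add, torusChar]
  congr 2
  push_cast
  ring

lemma one_le_Dnorm2_sub_one_mul {a : ℕ → ℕ → ℂ} (hf : Dnorm2 1 a ≠ ⊤)
    {μ : Measure (ℝ × ℝ)} [IsProbabilityMeasure μ]
    (hμ : Summable fun q : ℤ × ℤ => energyCoeff q * ‖muhat μ q.1 q.2‖ ^ 2)
    (hsupp : ∀ᵐ θ ∂μ, Tendsto (fun r : ℝ =>
        ∑' p : ℕ × ℕ, a p.1 p.2 * ((r : ℂ) * Complex.exp (Complex.I * (θ.1 : ℂ))) ^ p.1 *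
          ((r : ℂ) * Complex.exp (Complex.I * (θ.2 : ℂ))) ^ p.2)
        (nhdsWithin 1 (Set.Iio 1)) (nhds 0))
    {p : ℕ → ℕ → ℂ} {m : ℕ} (hp : IsPoly2 m p)
    (hfin : Dnorm2 1 (fun k l => conv2 p a k l - one2 k l) ≠ ⊤) :
    1 ≤ 4 * (Dnorm2 1 (fun k l => conv2 p a k l - one2 k l)).toReal *
      ∑' q : ℤ × ℤ, energyCoeff q * ‖muhat μ q.1 q.2‖ ^ 2 := by
  set h : ℕ → ℕ → ℂ := fun k l => conv2 p a k l - one2 k l with hh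
  set B := 4 * (Dnorm2 1 h).toReal * ∑' q : ℤ × ℤ, energyCoeff q * ‖muhat μ q.1 q.2‖ ^ 2
  set z : ℝ → ℝ → ℂ := fun r t => (r : ℂ) * Complex.exp (Complex.I * (t : ℂ)) with hz
  set H : ℝ → ℝ × ℝ → ℂ := fun r θ =>
    ∑' q : ℕ × ℕ, h q.1 q.2 * z r θ.1 ^ q.1 * z r θ.2 ^ q.2 with hH
  set P : ℝ → ℝ × ℝ → ℂ := fun r θ => ∑ i ∈ Finset.range (m + 1), ∑ j ∈ Finset.range (m + 1),
    p i j * z r θ.1 ^ i * z r θ.2 ^ j with hP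
  have hzn : ∀ r t : ℝ, 0 ≤ r → ‖z r t‖ = r := fun r t hr => by
    rw [hz, norm_mul, Complex.norm_real, Real.norm_of_nonneg hr, Complex.norm_exp]
    simp
  have hunit : Set.Ioo (0 : ℝ) 1 ∈ nhdsWithin (1 : ℝ) (Set.Iio 1) :=
    Ioo_mem_nhdsLT zero_lt_one
  have hterm : ∀ r θ (q : ℕ × ℕ), h q.1 q.2 * z r θ.1 ^ q.1 * z r θ.2 ^ q.2 =
      (h q.1 q.2 * (r : ℂ) ^ q.1 * (r : ℂ) ^ q.2) * torusChar (-(q.1 : ℤ), -(q.2 : ℤ)) θ := by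
    intro r θ q
    rw [mul_assoc, ofReal_mul_exp_pow_mul_pow]
    ring
  have hbn : ∀ r : ℝ, 0 ≤ r → ∀ q : ℕ × ℕ,
      ‖h q.1 q.2 * (r : ℂ) ^ q.1 * (r : ℂ) ^ q.2‖ = ‖h q.1 q.2‖ * r ^ q.1 * r ^ q.2 := by
    intro r hr q
    simp [abs_of_nonneg hr]
  have hbs : ∀ r ∈ Set.Ioo (0 : ℝ) 1,
      Summable fun q : ℕ × ℕ => ‖h q.1 q.2 * (r : ℂ) ^ q.1 * (r : ℂ) ^ q.2‖ := fun r hr =>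
    (summable_norm_mul_pow hfin hr.1.le hr.2).congr fun q => (hbn r hr.1.le q).symm
  have hHc : ∀ r ∈ Set.Ioo (0 : ℝ) 1, Continuous (H r) := by
    intro r hr
    simp only [hH, hterm]
    refine continuous_tsum (fun q => continuous_const.mul (continuous_torusChar _)) (hbs r hr)
      fun q θ => ?_
    rw [norm_mul, norm_torusChar, mul_one]
  have hHn : ∀ r ∈ Set.Ioo (0 : ℝ) 1, ∀ θ,
      ‖H r θ‖ ≤ ∑' q : ℕ × ℕ, ‖h q.1 q.2 * (r : ℂ) ^ q.1 * (r : ℂ) ^ q.2‖ := by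
    intro r hr θ
    simp only [hH, hterm]
    refine tsum_of_norm_bounded (hbs r hr).hasSum fun q => ?_
    rw [norm_mul, norm_torusChar, mul_one]
  have hHi : ∀ r ∈ Set.Ioo (0 : ℝ) 1, Integrable (H r) μ := fun r hr =>
    Integrable.of_bound (hHc r hr).aestronglyMeasurable _ (ae_of_all _ (hHn r hr))
  have hHB : ∀ r ∈ Set.Ioo (0 : ℝ) 1, (∫ θ, ‖H r θ‖ ∂μ) ^ 2 ≤ B := by
    intro r hr
    simp only [hH, hterm]
    refine sq_integral_norm_tsum_le hμ (hbs r hr) fun s => ?_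
    refine le_trans (Finset.sum_le_sum fun q _ => ?_) (sum_weight_mul_norm_sq_le hfin s)
    rw [hbn r hr.1.le, mul_assoc ‖h q.1 q.2‖]
    have h1 : r ^ q.1 * r ^ q.2 ≤ 1 :=
      mul_le_one₀ (pow_le_one₀ hr.1.le hr.2.le) (pow_nonneg hr.1.le _)
        (pow_le_one₀ hr.1.le hr.2.le)
    have h2 : 0 ≤ r ^ q.1 * r ^ q.2 := mul_nonneg (pow_nonneg hr.1.le _) (pow_nonneg hr.1.le _)
    gcongr
    exact mul_le_of_le_one_right (norm_nonneg _) h1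
  have hHP : ∀ r ∈ Set.Ioo (0 : ℝ) 1, ∀ θ, H r θ =
      P r θ * (∑' q : ℕ × ℕ, a q.1 q.2 * z r θ.1 ^ q.1 * z r θ.2 ^ q.2) - 1 := by
    intro r hr θ
    have ha : Summable fun q : ℕ × ℕ => a q.1 q.2 * z r θ.1 ^ q.1 * z r θ.2 ^ q.2 := by
      refine ((summable_norm_mul_pow hf hr.1.le hr.2).congr fun q => ?_).of_norm
      rw [norm_mul, norm_mul, norm_pow, norm_pow, hzn r _ hr.1.le, hzn r _ hr.1.le]
    refine HasSum.tsum_eq ?_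
    refine ((hasSum_conv2_mul_pow hp ha).sub
      (hasSum_one2_mul_pow (z r θ.1) (z r θ.2))).congr_fun fun q => ?_
    simp only [hh]
    ring
  have hlim : ∀ᵐ θ ∂μ, Tendsto (fun r => min ‖H r θ‖ 1) (nhdsWithin 1 (Set.Iio 1)) (nhds 1) := by
    filter_upwards [hsupp] with θ hθ
    have hPc : Continuous fun r => P r θ := by
      simp only [hP, hz]
      fun_prop
    have h1 := (((hPc.tendsto 1).mono_left nhdsWithin_le_nhds).mul hθ).sub_const 1
    rw [mul_zero, zero_sub] at h1
    have h2 : Tendsto (fun r => H r θ) (nhdsWithin 1 (Set.Iio 1)) (nhds (-1)) := by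
      refine h1.congr' ?_
      filter_upwards [hunit] with r hr
      exact (hHP r hr θ).symm
    simpa using h2.norm.min (tendsto_const_nhds (x := (1 : ℝ)))
  have hint := tendsto_integral_filter_of_dominated_convergence (μ := μ)
    (l := nhdsWithin (1 : ℝ) (Set.Iio 1)) (F := fun r θ => min ‖H r θ‖ 1) (fun _ => (1 : ℝ))
    (by
      filter_upwards [hunit] with r hr
      exact ((hHc r hr).norm.min continuous_const).aestronglyMeasurable)
    (Eventually.of_forall fun r => ae_of_all _ fun θ => by
      rw [Real.norm_of_nonneg (le_min (norm_nonneg _) zero_le_one)]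
      exact min_le_right _ _)
    (integrable_const _) hlim
  rw [integral_const, probReal_univ, one_smul] at hint
  have hsq := hint.pow 2
  rw [one_pow] at hsq
  refine le_of_tendsto hsq ?_
  filter_upwards [hunit] with r hr
  refine le_trans (pow_le_pow_left₀ (integral_nonneg fun θ => le_min (norm_nonneg _) zero_le_one)
    ?_ 2) (hHB r hr)
  exact integral_mono_of_nonneg (ae_of_all _ fun θ => le_min (norm_nonneg _) zero_le_one)
    (hHi r hr).norm (ae_of_all _ fun θ => min_le_left _ _)

/-- if f is in the Dirichlet space 𝔇₁ of the bidisk and some probability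
measure of finite logarithmic energy is carried by the radial boundary zero set of f,
then f is not cyclic in 𝔇₁. -/
theorem stmt17 (a : ℕ → ℕ → ℂ) (hf : Dnorm2 1 a ≠ ⊤)
    (μ : MeasureTheory.Measure (ℝ × ℝ)) (hμ : MeasureTheory.IsProbabilityMeasure μ)
    (hE : energy μ ≠ ⊤)
    (hsupp : ∀ᵐ θ ∂μ, Tendsto (fun r : ℝ =>
        ∑' p : ℕ × ℕ, a p.1 p.2 * ((r : ℂ) * Complex.exp (Complex.I * (θ.1 : ℂ))) ^ p.1 *
          ((r : ℂ) * Complex.exp (Complex.I * (θ.2 : ℂ))) ^ p.2)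
        (nhdsWithin 1 (Set.Iio 1)) (nhds 0)) :
    ¬ Cyclic2 1 a := by
  rintro ⟨p, hp, hlim⟩
  have hsum := summable_energyCoeff_mul_norm_sq hE
  have hreal := ((ENNReal.tendsto_toReal ENNReal.zero_ne_top).comp hlim).const_mul 4 |>.mul_const
    (∑' q : ℤ × ℤ, energyCoeff q * ‖muhat μ q.1 q.2‖ ^ 2)
  rw [ENNReal.toReal_zero, mul_zero, zero_mul] at hreal
  have hfin := hlim.eventually_lt_const ENNReal.zero_lt_top
  obtain ⟨n, hn, hn1⟩ := (hfin.and (hreal.eventually_lt_const one_pos)).exists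
  obtain ⟨m, hm⟩ := hp n
  exact absurd hn1 (one_le_Dnorm2_sub_one_mul hf hsum hsupp hm hn.ne).not_gt
end

section
/- Let α ≤ 1 and f(z1,z2)=g(z1)h(z2), where g,h are analytic on the closed unit disk with no zeros in the open disk. Then there is a constant C = C(g,h,α) such that dist²_{𝔇_α}(1, f·𝔓_n) ≤ C φ_α^{−1}(n+1) for all large n, where 𝔓_n is the space of polynomials Σ_{k,l≤n} c_{k,l}z1^k z2^l, φ_α(s)=s^{1−α} for α<1 and φ_1(s)=log⁺ s. -/
open scoped ENNReal NNReal Classical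
open Filter

/-- The rate function φ_α: φ₁ = log⁺ and φ_α(s) = s^{1-α} for α < 1. -/
noncomputable def Phi (α : ℝ) (s : ℝ) : ℝ := if α = 1 then max (Real.log s) 0 else s ^ (1 - α)

/-- The partial sums `∑_{k ≤ n} (k+1)^{-α}`. -/
noncomputable def weightSum (α : ℝ) (n : ℕ) : ℝ :=
  ∑ k ∈ Finset.range (n + 1), ((k : ℝ) + 1) ^ (-α)

lemma weightSum_mono (α : ℝ) : Monotone (weightSum α) := by
  intro m n hmn
  refine Finset.sum_le_sum_of_subset_of_nonneg
    (Finset.range_mono (by omega)) fun k _ _ => by positivity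

lemma one_le_weightSum (α : ℝ) (n : ℕ) : 1 ≤ weightSum α n := by
  have h := weightSum_mono α (Nat.zero_le n)
  simpa [weightSum] using h

lemma weightSum_pos (α : ℝ) (n : ℕ) : 0 < weightSum α n :=
  one_pos.trans_le (one_le_weightSum α n)

lemma rpow_neg_le_two_rpow_abs_mul (α : ℝ) {x y : ℝ} (hx : 0 < x) (hy : 0 < y)
    (hxy : x ≤ 2 * y) (hyx : y ≤ 2 * x) : y ^ (-α) ≤ 2 ^ |α| * x ^ (-α) := by
  rcases le_total 0 α with h | h
  · rw [abs_of_nonneg h, Real.rpow_neg hx.le, Real.rpow_neg hy.le, ← div_eq_mul_inv,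
      inv_le_iff_one_le_mul₀ (by positivity), div_mul_eq_mul_div, one_le_div (by positivity),
      ← Real.mul_rpow (by norm_num) hy.le]
    exact Real.rpow_le_rpow hx.le hxy h
  · rw [abs_of_nonpos h, ← Real.mul_rpow (by norm_num) hx.le]
    exact Real.rpow_le_rpow hy.le hyx (by linarith)

lemma sum_antidiagonal_weight (α : ℝ) (k : ℕ) :
    ∑ p ∈ Finset.HasAntidiagonal.antidiagonal k, (((p.1 : ℝ) + 1) ^ (-α) + ((p.2 : ℝ) + 1) ^ (-α)) =
      2 * weightSum α k := by
  rw [Finset.sum_add_distrib, two_mul]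
  congr 1
  · rw [Finset.Nat.sum_antidiagonal_eq_sum_range_succ_mk]
    rfl
  · rw [← Finset.Nat.sum_antidiagonal_swap, Finset.Nat.sum_antidiagonal_eq_sum_range_succ_mk]
    rfl

/-- In a decomposition `i + j = k` at least one of the indices is comparable with `k`. -/
lemma comparable_of_add_eq {i j k : ℕ} (h : i + j = k) :
    (((k : ℝ) + 1 ≤ 2 * ((i : ℝ) + 1)) ∧ ((i : ℝ) + 1 ≤ 2 * ((k : ℝ) + 1))) ∨
    (((k : ℝ) + 1 ≤ 2 * ((j : ℝ) + 1)) ∧ ((j : ℝ) + 1 ≤ 2 * ((k : ℝ) + 1))) := by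
  norm_cast
  omega

lemma sum_antidiagonal_weight_mul_le (α : ℝ) (k : ℕ) :
    ∑ p ∈ Finset.HasAntidiagonal.antidiagonal k, ((p.1 : ℝ) + 1) ^ (-α) * ((p.2 : ℝ) + 1) ^ (-α) ≤
      2 ^ |α| * 2 * (((k : ℝ) + 1) ^ (-α) * weightSum α k) := by
  calc _ ≤ ∑ p ∈ Finset.HasAntidiagonal.antidiagonal k, 2 ^ |α| * ((k : ℝ) + 1) ^ (-α) *
        (((p.1 : ℝ) + 1) ^ (-α) + ((p.2 : ℝ) + 1) ^ (-α)) := by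
        refine Finset.sum_le_sum fun p hp => ?_
        have h1 : (0 : ℝ) ≤ ((p.1 : ℝ) + 1) ^ (-α) := by positivity
        have h2 : (0 : ℝ) ≤ ((p.2 : ℝ) + 1) ^ (-α) := by positivity
        have h3 : (0 : ℝ) ≤ 2 ^ |α| * ((k : ℝ) + 1) ^ (-α) := by positivity
        rcases comparable_of_add_eq (Finset.HasAntidiagonal.mem_antidiagonal.1 hp) with ⟨h, h'⟩ | ⟨h, h'⟩
        · have := rpow_neg_le_two_rpow_abs_mul α (by positivity) (by positivity) h h'
          nlinarith [mul_le_mul_of_nonneg_right this h2, mul_nonneg h3 h1]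
        · have := rpow_neg_le_two_rpow_abs_mul α (by positivity) (by positivity) h h'
          nlinarith [mul_le_mul_of_nonneg_right this h1, mul_nonneg h3 h2]
    _ = _ := by
        rw [← Finset.mul_sum, sum_antidiagonal_weight]
        ring

lemma weightSum_two_mul_add_one_le (α : ℝ) (m : ℕ) :
    weightSum α (2 * m + 1) ≤ 2 ^ |α| * 2 * weightSum α m := by
  have hw : ∀ a b : ℕ, a + 1 ≤ 2 * (b + 1) → b + 1 ≤ 2 * (a + 1) →
      ((b : ℝ) + 1) ^ (-α) ≤ 2 ^ |α| * ((a : ℝ) + 1) ^ (-α) := fun a b h h' =>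
    rpow_neg_le_two_rpow_abs_mul α (by positivity) (by positivity) (by exact_mod_cast h)
      (by exact_mod_cast h')
  induction m with
  | zero =>
    have h0 := hw 0 0 (by norm_num) (by norm_num)
    have h1 := hw 0 1 (by norm_num) (by norm_num)
    simp only [weightSum, Finset.sum_range_succ, Finset.range_zero, Finset.sum_empty] at *
    linarith
  | succ m ih =>
    have h0 := hw (m + 1) (2 * m + 2) (by omega) (by omega)
    have h1 := hw (m + 1) (2 * m + 3) (by omega) (by omega)
    have e0 : weightSum α (2 * (m + 1) + 1) = weightSum α (2 * m + 1) +
        (((2 * m + 2 : ℕ) : ℝ) + 1) ^ (-α) + (((2 * m + 3 : ℕ) : ℝ) + 1) ^ (-α) := by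
      rw [weightSum, show 2 * (m + 1) + 1 + 1 = 2 * m + 1 + 1 + 1 + 1 by ring,
        Finset.sum_range_succ, Finset.sum_range_succ]
      rfl
    have e1 : weightSum α (m + 1) = weightSum α m + (((m + 1 : ℕ) : ℝ) + 1) ^ (-α) := by
      rw [weightSum, Finset.sum_range_succ]
      rfl
    rw [e0, e1]
    linarith

lemma weightSum_le_half (α : ℝ) (n : ℕ) :
    weightSum α n ≤ 2 ^ |α| * 2 * weightSum α (n / 2) :=
  (weightSum_mono α (by omega)).trans (weightSum_two_mul_add_one_le α (n / 2))

lemma Phi_le_weightSum (α : ℝ) (n : ℕ) :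
    Phi α ((n : ℝ) + 1) ≤ 2 ^ |α| * 2 * weightSum α n := by
  rw [Phi]
  split_ifs with h
  · subst h
    have hW : (1 : ℝ) ≤ weightSum 1 n := one_le_weightSum 1 n
    have hlog : Real.log ((n : ℝ) + 1) ≤ weightSum 1 n := by
      have h1 := log_add_one_le_harmonic n
      push_cast at h1
      refine h1.trans ?_
      rw [weightSum, harmonic]
      push_cast
      refine (Finset.sum_le_sum_of_subset_of_nonneg (Finset.range_mono (Nat.le_succ n))
        fun k _ _ => by positivity).trans (Finset.sum_le_sum fun k _ => ?_)
      rw [Real.rpow_neg_one]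
    have : max (Real.log ((n : ℝ) + 1)) 0 ≤ weightSum 1 n := max_le hlog (by linarith)
    rw [abs_one, Real.rpow_one]
    linarith
  · have hsum : ∑ p ∈ Finset.HasAntidiagonal.antidiagonal n, ((n : ℝ) + 1) ^ (-α) ≤
        ∑ p ∈ Finset.HasAntidiagonal.antidiagonal n,
          2 ^ |α| * (((p.1 : ℝ) + 1) ^ (-α) + ((p.2 : ℝ) + 1) ^ (-α)) := by
      refine Finset.sum_le_sum fun p hp => ?_
      have h1 : (0 : ℝ) ≤ 2 ^ |α| * ((p.1 : ℝ) + 1) ^ (-α) := by positivity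
      have h2 : (0 : ℝ) ≤ 2 ^ |α| * ((p.2 : ℝ) + 1) ^ (-α) := by positivity
      rcases comparable_of_add_eq (Finset.HasAntidiagonal.mem_antidiagonal.1 hp) with ⟨h, h'⟩ | ⟨h, h'⟩
      · have := rpow_neg_le_two_rpow_abs_mul α (by positivity) (by positivity) h' h
        linarith
      · have := rpow_neg_le_two_rpow_abs_mul α (by positivity) (by positivity) h' h
        linarith
    rw [← Finset.mul_sum, sum_antidiagonal_weight, Finset.sum_const,
      Finset.Nat.card_antidiagonal, nsmul_eq_mul] at hsum
    rw [show (1 : ℝ) - α = 1 + -α by ring, Real.rpow_add (by positivity), Real.rpow_one]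
    push_cast at hsum
    linarith

open Polynomial in
/-- `P` has polynomial almost-inverses `q` with `1 - P q` of degree at most `n` and with coefficients
of the size of the normalised weights `(k+1)^{-α}`. -/
def HasAlmostInverses (α : ℝ) (P : ℂ[X]) : Prop :=
  ∃ C : ℝ, 0 ≤ C ∧ ∀ n : ℕ, ∃ q : ℂ[X],
    (∀ k, ‖(1 - P * q).coeff k‖ ≤ C * ((k : ℝ) + 1) ^ (-α) / weightSum α n) ∧
    ∀ k, n < k → (1 - P * q).coeff k = 0

lemma HasAlmostInverses.one (α : ℝ) : HasAlmostInverses α 1 :=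
  ⟨0, le_rfl, fun _ => ⟨1, by simp⟩⟩

open Polynomial in
lemma HasAlmostInverses.X_sub_C (α : ℝ) {ζ : ℂ} (hζ : ‖ζ‖ = 1) :
    HasAlmostInverses α (X - C ζ) := by
  refine ⟨1, zero_le_one, fun n => ?_⟩
  have hW : (weightSum α n : ℂ) ≠ 0 := by exact_mod_cast (weightSum_pos α n).ne'
  have hζ0 : ζ ≠ 0 := by
    rintro rfl
    simp at hζ
  set c : ℕ → ℂ := fun k => (((k : ℝ) + 1) ^ (-α) : ℝ) / (weightSum α n : ℂ) * (ζ ^ k)⁻¹ with hc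
  set s : ℂ[X] := ∑ k ∈ Finset.range (n + 1), monomial k (c k) with hs
  have hcoeff : ∀ k, s.coeff k = if k < n + 1 then c k else 0 := by
    intro k
    simp [hs, coeff_monomial]
  have hroot : (1 - s).IsRoot ζ := by
    have h1 : ∀ k ∈ Finset.range (n + 1), c k * ζ ^ k =
        (((k : ℝ) + 1) ^ (-α) : ℝ) / (weightSum α n : ℂ) := fun k _ => by
      rw [hc]
      field_simp
    rw [IsRoot, eval_sub, eval_one, hs, eval_finsetSum]
    simp only [eval_monomial]
    rw [Finset.sum_congr rfl h1, ← Finset.sum_div, sub_eq_zero, eq_comm, div_eq_one_iff_eq hW,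
      weightSum]
    push_cast
    rfl
  obtain ⟨q, hq⟩ := dvd_iff_isRoot.2 hroot
  have hsq : 1 - (X - C ζ) * q = s := by rw [← hq]; ring
  refine ⟨q, fun k => ?_, fun k hk => ?_⟩
  · rw [hsq, hcoeff]
    have hpos := weightSum_pos α n
    split_ifs
    · have hr : (0 : ℝ) ≤ ((k : ℝ) + 1) ^ (-α) := by positivity
      rw [hc]
      simp only [norm_mul, norm_div, norm_inv, norm_pow, hζ, Complex.norm_real, Real.norm_eq_abs,
        abs_of_nonneg hr, abs_of_pos hpos]
      simp
    · simp only [norm_zero]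
      positivity
  · rw [hsq, hcoeff, if_neg (by omega)]

open Polynomial in
lemma HasAlmostInverses.mul {α : ℝ} {P Q : ℂ[X]} (hP : HasAlmostInverses α P)
    (hQ : HasAlmostInverses α Q) : HasAlmostInverses α (P * Q) := by
  obtain ⟨A, hA, hP⟩ := hP
  obtain ⟨B, hB, hQ⟩ := hQ
  set K : ℝ := 2 ^ |α| * 2 with hK
  have hK0 : 0 < K := by positivity
  refine ⟨(A + B) * K + A * B * K * K * K, by positivity, fun n => ?_⟩
  obtain ⟨p, hp, hp'⟩ := hP (n / 2)
  obtain ⟨q, hq, hq'⟩ := hQ (n / 2)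
  set s := 1 - P * p with hs
  set t := 1 - Q * q with ht
  have hst : 1 - P * Q * (p * q) = s + t - s * t := by rw [hs, ht]; ring
  have hst0 : ∀ k, n < k → (s * t).coeff k = 0 := by
    intro k hk
    rw [coeff_mul]
    refine Finset.sum_eq_zero fun x hx => ?_
    rw [Finset.HasAntidiagonal.mem_antidiagonal] at hx
    by_cases h : n / 2 < x.1
    · rw [hp' _ h, zero_mul]
    · rw [hq' x.2 (by omega), mul_zero]
  have hWm := weightSum_pos α (n / 2)
  have hWn := weightSum_pos α n
  have hhalf : weightSum α n ≤ K * weightSum α (n / 2) := weightSum_le_half α n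
  have hinv : (weightSum α (n / 2))⁻¹ ≤ K / weightSum α n := by
    rw [le_div_iff₀ hWn, inv_mul_le_iff₀ hWm]
    linarith
  have hmul : ∀ k, ‖(s * t).coeff k‖ ≤
      A * B * K * K * K * ((k : ℝ) + 1) ^ (-α) / weightSum α n := by
    intro k
    rcases lt_or_ge n k with hk | hk
    · rw [hst0 k hk, norm_zero]
      positivity
    have hw : (0 : ℝ) ≤ ((k : ℝ) + 1) ^ (-α) := by positivity
    calc ‖(s * t).coeff k‖
        ≤ ∑ x ∈ Finset.HasAntidiagonal.antidiagonal k, ‖s.coeff x.1‖ * ‖t.coeff x.2‖ := by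
          rw [coeff_mul]
          exact (norm_sum_le _ _).trans_eq (by simp)
      _ ≤ ∑ x ∈ Finset.HasAntidiagonal.antidiagonal k, (A * ((x.1 : ℝ) + 1) ^ (-α) / weightSum α (n / 2)) *
            (B * ((x.2 : ℝ) + 1) ^ (-α) / weightSum α (n / 2)) :=
          Finset.sum_le_sum fun x _ =>
            mul_le_mul (hp _) (hq _) (norm_nonneg _) (by positivity)
      _ = A * B * (weightSum α (n / 2))⁻¹ * (weightSum α (n / 2))⁻¹ *
            ∑ x ∈ Finset.HasAntidiagonal.antidiagonal k, ((x.1 : ℝ) + 1) ^ (-α) * ((x.2 : ℝ) + 1) ^ (-α) := by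
          rw [Finset.mul_sum]
          refine Finset.sum_congr rfl fun x _ => ?_
          ring
      _ ≤ A * B * (K / weightSum α n) * (K / weightSum α n) *
            (K * (((k : ℝ) + 1) ^ (-α) * weightSum α n)) := by
          have h1 := sum_antidiagonal_weight_mul_le α k
          have h2 := weightSum_mono α hk
          gcongr
          exact h1.trans (by gcongr)
      _ = _ := by
          field_simp
  refine ⟨p * q, fun k => ?_, fun k hk => ?_⟩
  · have hw : (0 : ℝ) ≤ ((k : ℝ) + 1) ^ (-α) := by positivity
    have h1 : ‖s.coeff k‖ ≤ A * K * ((k : ℝ) + 1) ^ (-α) / weightSum α n := by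
      refine (hp k).trans ?_
      rw [div_eq_mul_inv]
      refine (mul_le_mul_of_nonneg_left hinv (by positivity)).trans_eq (by ring)
    have h2 : ‖t.coeff k‖ ≤ B * K * ((k : ℝ) + 1) ^ (-α) / weightSum α n := by
      refine (hq k).trans ?_
      rw [div_eq_mul_inv]
      refine (mul_le_mul_of_nonneg_left hinv (by positivity)).trans_eq (by ring)
    rw [hst, coeff_sub, coeff_add]
    refine ((norm_sub_le _ _).trans (add_le_add (norm_add_le _ _) le_rfl)).trans ?_
    refine (add_le_add (add_le_add h1 h2) (hmul k)).trans_eq ?_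
    ring
  · rw [hst, coeff_sub, coeff_add, hp' k (by omega), hq' k (by omega), hst0 k hk]
    simp

lemma HasAlmostInverses.pow {α : ℝ} {P : Polynomial ℂ} (hP : HasAlmostInverses α P) (n : ℕ) :
    HasAlmostInverses α (P ^ n) := by
  induction n with
  | zero => simpa using HasAlmostInverses.one α
  | succ n ih => simpa [pow_succ] using ih.mul hP

/-- The Taylor series at the origin as a formal power series. -/
noncomputable def taylorPowerSeries (f : ℂ → ℂ) : PowerSeries ℂ :=
  PowerSeries.mk fun n => iteratedDeriv n f 0 / n.factorial

lemma taylorPowerSeries_congr {f g : ℂ → ℂ} (h : f =ᶠ[nhds 0] g) :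
    taylorPowerSeries f = taylorPowerSeries g := by
  ext n
  simp [taylorPowerSeries, h.iteratedDeriv_eq n]

lemma coeff_taylorPowerSeries {f : ℂ → ℂ} {p : FormalMultilinearSeries ℂ ℂ ℂ}
    (h : HasFPowerSeriesAt f p 0) (n : ℕ) :
    PowerSeries.coeff n (taylorPowerSeries f) = p.coeff n := by
  rw [h.eq_formalMultilinearSeries h.analyticAt.hasFPowerSeriesAt]
  simp [taylorPowerSeries]

lemma taylorPowerSeries_mul {f g : ℂ → ℂ} (hf : AnalyticAt ℂ f 0) (hg : AnalyticAt ℂ g 0) :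
    taylorPowerSeries (f * g) = taylorPowerSeries f * taylorPowerSeries g := by
  ext n
  rw [PowerSeries.coeff_mul, Finset.Nat.sum_antidiagonal_eq_sum_range_succ_mk]
  simp only [taylorPowerSeries, PowerSeries.coeff_mk]
  rw [iteratedDeriv_mul hf.contDiffAt hg.contDiffAt, Finset.sum_div]
  refine Finset.sum_congr rfl fun i hi => ?_
  rw [Nat.cast_choose _ (by grind)]
  field_simp [Nat.factorial_ne_zero]

lemma taylorPowerSeries_eval (P : Polynomial ℂ) :
    taylorPowerSeries (fun z => P.eval z) = (P : PowerSeries ℂ) := by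
  have h : HasFPowerSeriesAt (fun z => P.eval z)
      (FormalMultilinearSeries.ofScalars ℂ fun n => P.coeff n) 0 := by
    rw [hasFPowerSeriesAt_iff]
    refine Eventually.of_forall fun z => ?_
    rw [zero_add, Polynomial.eval_eq_sum_range]
    simp only [FormalMultilinearSeries.coeff_ofScalars, smul_eq_mul]
    simp_rw [mul_comm (P.coeff _)]
    refine hasSum_sum_of_ne_finset_zero fun n hn => ?_
    rw [Polynomial.coeff_eq_zero_of_natDegree_lt (by simpa using hn), mul_zero]
  ext n
  rw [coeff_taylorPowerSeries h, FormalMultilinearSeries.coeff_ofScalars, Polynomial.coeff_coe]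

lemma taylorPowerSeries_decay {f : ℂ → ℂ} (hf : AnalyticOnNhd ℂ f (Metric.closedBall 0 1)) :
    ∃ C R : ℝ, 1 < R ∧ ∀ k, ‖PowerSeries.coeff k (taylorPowerSeries f)‖ ≤ C / R ^ k := by
  obtain ⟨δ, hδ, hsub⟩ := (isCompact_closedBall (0 : ℂ) 1).exists_thickening_subset_open
    (isOpen_analyticAt ℂ f) hf
  rw [thickening_closedBall hδ zero_le_one] at hsub
  obtain ⟨r, hr1, hr2⟩ := exists_between (show (1 : ℝ) < δ + 1 by linarith)
  obtain ⟨R, hR1, hR2⟩ := exists_between hr1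
  lift r to ℝ≥0 using by linarith
  lift R to ℝ≥0 using by linarith
  have hd : DifferentiableOn ℂ f (Metric.closedBall 0 r) := fun z hz =>
    (hsub (Metric.closedBall_subset_ball hr2 hz)).differentiableAt.differentiableWithinAt
  have hp := hd.hasFPowerSeriesOnBall (by exact_mod_cast zero_lt_one.trans hr1)
  obtain ⟨C, -, hC⟩ := (cauchyPowerSeries f 0 r).norm_le_div_pow_of_pos_of_lt_radius (r := R)
    (by exact_mod_cast zero_lt_one.trans hR1)
    (lt_of_lt_of_le (by exact_mod_cast hR2) hp.r_le)
  refine ⟨C, R, hR1, fun k => ?_⟩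
  rw [coeff_taylorPowerSeries hp.hasFPowerSeriesAt, ← FormalMultilinearSeries.norm_apply_eq_norm_coef]
  exact hC k

lemma exists_eval_eq_factorizedRational (α : ℝ) {d : ℂ → ℤ} (hd : d.HasFiniteSupport)
    (h0 : 0 ≤ d) (h1 : ∀ ζ, d ζ ≠ 0 → ‖ζ‖ = 1) :
    ∃ P : Polynomial ℂ, HasAlmostInverses α P ∧
      (∏ᶠ u, (fun z : ℂ => z - u) ^ d u) = fun z => P.eval z := by
  refine ⟨∏ ζ ∈ hd.toFinset, (Polynomial.X - Polynomial.C ζ) ^ (d ζ).toNat, ?_, ?_⟩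
  · refine Finset.prod_induction _ (HasAlmostInverses α) (fun _ _ => HasAlmostInverses.mul)
      (HasAlmostInverses.one α) fun ζ hζ => ?_
    exact (HasAlmostInverses.X_sub_C α (h1 ζ ((Set.Finite.mem_toFinset hd).1 hζ))).pow _
  · rw [finprod_eq_prod_of_mulSupport_subset (s := hd.toFinset)]
    · ext z
      rw [Finset.prod_apply, Polynomial.eval_prod]
      refine Finset.prod_congr rfl fun ζ _ => ?_
      rw [Pi.pow_apply, Polynomial.eval_pow, Polynomial.eval_sub, Polynomial.eval_X,
        Polynomial.eval_C, ← zpow_natCast, Int.toNat_of_nonneg (h0 ζ)]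
    · rw [Function.FactorizedRational.mulSupport]
      exact (Set.Finite.coe_toFinset hd).ge

/-- A power series with radius of convergence larger than one and without zeros in the open disk
is a product of a polynomial with almost-inverses and of an invertible such power series. -/
lemma exists_factorization (α : ℝ) {g : ℕ → ℂ}
    (hg : ∃ C R : ℝ, 1 < R ∧ ∀ k, ‖g k‖ ≤ C / R ^ k)
    (hgz : ∀ z : ℂ, ‖z‖ < 1 → (∑' k : ℕ, g k * z ^ k) ≠ 0) :
    ∃ (P : Polynomial ℂ) (u v : PowerSeries ℂ), HasAlmostInverses α P ∧
      PowerSeries.mk g = P * u ∧ u * v = 1 ∧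
      (∃ C R : ℝ, 1 < R ∧ ∀ k, ‖PowerSeries.coeff k u‖ ≤ C / R ^ k) ∧
      ∃ C R : ℝ, 1 < R ∧ ∀ k, ‖PowerSeries.coeff k v‖ ≤ C / R ^ k := by
  obtain ⟨C, R, hR, hC⟩ := hg
  lift R to ℝ≥0 using by linarith
  have hR0 : (0 : ℝ) < R := by linarith
  set p := FormalMultilinearSeries.ofScalars ℂ g with hp
  have hrad : (R : ℝ≥0∞) ≤ p.radius := by
    refine p.le_radius_of_bound C fun n => ?_
    rw [← le_div_iff₀ (by positivity), FormalMultilinearSeries.norm_apply_eq_norm_coef, hp,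
      FormalMultilinearSeries.coeff_ofScalars]
    exact hC n
  have hps := p.hasFPowerSeriesOnBall (lt_of_lt_of_le (by exact_mod_cast hR0) hrad)
  set F := p.sum with hF
  have hFeval : ∀ z, F z = ∑' k, g k * z ^ k := by
    intro z
    rw [hF, FormalMultilinearSeries.sum]
    refine tsum_congr fun k => ?_
    rw [FormalMultilinearSeries.apply_eq_pow_smul_coeff, hp,
      FormalMultilinearSeries.coeff_ofScalars, smul_eq_mul, mul_comm]
  set U : Set ℂ := Metric.closedBall 0 1 with hU
  have hFan : AnalyticOnNhd ℂ F U := by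
    refine hps.analyticOnNhd.mono fun z hz => ?_
    rw [hU, mem_closedBall_zero_iff] at hz
    rw [Metric.mem_eball, edist_zero_right]
    refine lt_of_lt_of_le ?_ hrad
    rw [← ofReal_norm, ← ENNReal.ofReal_coe_nnreal]
    exact (ENNReal.ofReal_lt_ofReal_iff hR0).2 (by linarith)
  have h0U : (0 : ℂ) ∈ U := by simp [hU]
  have hFne : ∀ z : ℂ, ‖z‖ < 1 → F z ≠ 0 := fun z hz => by
    rw [hFeval]
    exact hgz z hz
  have hmero := hFan.meromorphicOn
  have hord0 : ∀ z : ℂ, ‖z‖ < 1 → meromorphicOrderAt F z = 0 := fun z hz => by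
    have hz' : z ∈ U := by rw [hU, mem_closedBall_zero_iff]; exact hz.le
    exact ((hFan z hz').meromorphicNFAt.meromorphicOrderAt_eq_zero_iff).2 (hFne z hz)
  have hord : ∀ z : U, meromorphicOrderAt F z ≠ ⊤ := by
    have hconn : IsConnected U := (convex_closedBall 0 1).isConnected ⟨0, h0U⟩
    rw [← hmero.exists_meromorphicOrderAt_ne_top_iff_forall hconn]
    exact ⟨⟨0, h0U⟩, by simp [hord0 0 (by simp)]⟩
  have hfin : (MeromorphicOn.divisor F U).support.Finite :=
    (MeromorphicOn.divisor F U).finiteSupport (isCompact_closedBall 0 1)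
  obtain ⟨G, hGan, hGne, hFG⟩ := hmero.extract_zeros_poles hord hfin
  have hsupp : ∀ ζ, MeromorphicOn.divisor F U ζ ≠ 0 → ‖ζ‖ = 1 := by
    intro ζ hζ
    have hζU : ζ ∈ U := (MeromorphicOn.divisor F U).supportWithinDomain hζ
    refine le_antisymm (by simpa [hU] using hζU) (not_lt.1 fun hlt => hζ ?_)
    rw [MeromorphicOn.divisor_apply hmero hζU, hord0 ζ hlt]
    simp
  obtain ⟨P, hP, hPeq⟩ := exists_eval_eq_factorizedRational α
    (d := fun z => MeromorphicOn.divisor F U z) hfin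
    (fun z => MeromorphicOn.AnalyticOnNhd.divisor_nonneg hFan z) hsupp
  have hPan : AnalyticAt ℂ (fun z => P.eval z) 0 := (AnalyticAt.aeval_polynomial analyticAt_id P)
  have hnear : F =ᶠ[nhds 0] (fun z => P.eval z) * G := by
    rw [hPeq] at hFG
    have h1 : F =ᶠ[nhdsWithin 0 {0}ᶜ] (fun z => P.eval z) * G := by
      have h2 := mem_codiscreteWithin.1 hFG 0 h0U
      rw [disjoint_principal_right] at h2
      have h3 : U ∈ nhdsWithin (0 : ℂ) {0}ᶜ :=
        mem_nhdsWithin_of_mem_nhds (Metric.closedBall_mem_nhds 0 one_pos)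
      filter_upwards [h2, h3] with z hz hzU
      by_contra hne
      exact hz ⟨hzU, hne⟩
    exact ((hFan 0 h0U).frequently_eq_iff_eventually_eq (hPan.mul (hGan 0 h0U))).1 h1.frequently
  have hGinv : AnalyticOnNhd ℂ G⁻¹ U := hGan.inv fun z hz => hGne ⟨z, hz⟩
  refine ⟨P, taylorPowerSeries G, taylorPowerSeries G⁻¹, hP, ?_, ?_,
    taylorPowerSeries_decay hGan, taylorPowerSeries_decay hGinv⟩
  · rw [← taylorPowerSeries_eval P, ← taylorPowerSeries_mul hPan (hGan 0 h0U),
      ← taylorPowerSeries_congr hnear]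
    ext n
    rw [coeff_taylorPowerSeries hps.hasFPowerSeriesAt, hp,
      FormalMultilinearSeries.coeff_ofScalars, PowerSeries.coeff_mk]
  · have h1 : G * G⁻¹ =ᶠ[nhds 0] fun z => (1 : Polynomial ℂ).eval z := by
      filter_upwards [Metric.closedBall_mem_nhds (0 : ℂ) one_pos] with z hz
      simpa using mul_inv_cancel₀ (hGne ⟨z, hz⟩)
    rw [← taylorPowerSeries_mul (hGan 0 h0U) (hGinv 0 h0U), taylorPowerSeries_congr h1,
      taylorPowerSeries_eval]
    simp

lemma wt_eq_ofReal (α : ℝ) (k : ℕ) : wt α k = ENNReal.ofReal (((k : ℝ) + 1) ^ α) := by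
  rw [wt, ← ENNReal.ofReal_rpow_of_pos (by positivity), ENNReal.ofReal_add (by positivity) one_pos.le,
    ENNReal.ofReal_natCast, ENNReal.ofReal_one]

lemma coe_nnnorm_le_ofReal {x : ℂ} {b : ℝ} (h : ‖x‖ ≤ b) : (‖x‖₊ : ℝ≥0∞) ≤ ENNReal.ofReal b := by
  rw [← ENNReal.ofReal_coe_nnreal, coe_nnnorm]
  exact ENNReal.ofReal_le_ofReal h

lemma one_le_wt_abs (α : ℝ) (k : ℕ) : 1 ≤ wt |α| k := by
  rw [wt_eq_ofReal, ← ENNReal.ofReal_one]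
  exact ENNReal.ofReal_le_ofReal
    (Real.one_le_rpow (by linarith [(Nat.cast_nonneg k : (0 : ℝ) ≤ k)]) (abs_nonneg α))

lemma wt_add_le (α : ℝ) (i j : ℕ) : wt α (i + j) ≤ wt |α| i * wt α j := by
  rw [wt_eq_ofReal, wt_eq_ofReal, wt_eq_ofReal, ← ENNReal.ofReal_mul (by positivity)]
  refine ENNReal.ofReal_le_ofReal ?_
  have hi : (0 : ℝ) ≤ i := Nat.cast_nonneg i
  have hj : (0 : ℝ) ≤ j := Nat.cast_nonneg j
  push_cast
  rcases le_total 0 α with h | h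
  · rw [abs_of_nonneg h, ← Real.mul_rpow (by positivity) (by positivity)]
    exact Real.rpow_le_rpow (by positivity) (by nlinarith) h
  · calc ((i : ℝ) + j + 1) ^ α ≤ ((j : ℝ) + 1) ^ α :=
          Real.rpow_le_rpow_of_nonpos (by positivity) (by linarith) h
      _ ≤ _ := le_mul_of_one_le_left (by positivity)
          (Real.one_le_rpow (by linarith) (abs_nonneg α))

lemma tsum_sum_antidiagonal_mul (a b : ℕ → ℝ≥0∞) :
    ∑' k, ∑ p ∈ Finset.HasAntidiagonal.antidiagonal k, a p.1 * b p.2 =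
      (∑' i, a i) * ∑' j, b j := by
  have h1 : ∀ k, ∑ p ∈ Finset.HasAntidiagonal.antidiagonal k, a p.1 * b p.2 =
      ∑' p : Finset.HasAntidiagonal.antidiagonal k, a p.1.1 * b p.1.2 := fun k => by
    rw [tsum_fintype, Finset.sum_coe_sort (Finset.HasAntidiagonal.antidiagonal k)
      fun p => a p.1 * b p.2]
  simp_rw [h1]
  rw [← ENNReal.tsum_sigma (fun k (p : Finset.HasAntidiagonal.antidiagonal k) =>
      a p.1.1 * b p.1.2)]
  refine (Finset.HasAntidiagonal.sigmaAntidiagonalEquivProd.tsum_eq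
    (fun p : ℕ × ℕ => a p.1 * b p.2)).trans ?_
  rw [ENNReal.tsum_prod (f := fun i j => a i * b j), ← ENNReal.tsum_mul_right]
  simp_rw [ENNReal.tsum_mul_left]

/-- A power series whose coefficients are summable against `(k+1)^{|α|}` is a multiplier. -/
lemma dnorm2_mul_le (α : ℝ) (e s : PowerSeries ℂ) :
    dnorm2 α (fun k => PowerSeries.coeff k (e * s)) ≤
      (∑' j, wt |α| j * (‖PowerSeries.coeff j e‖₊ : ℝ≥0∞)) ^ 2 *
        dnorm2 α (fun k => PowerSeries.coeff k s) := by
  set a : ℕ → ℝ≥0∞ := fun j => wt |α| j * (‖PowerSeries.coeff j e‖₊ : ℝ≥0∞) with ha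
  set b : ℕ → ℝ≥0∞ := fun j => wt α j * (‖PowerSeries.coeff j s‖₊ : ℝ≥0∞) ^ 2 with hb
  have key : ∀ k, wt α k * (‖PowerSeries.coeff k (e * s)‖₊ : ℝ≥0∞) ^ 2 ≤
      (∑' j, a j) * ∑ p ∈ Finset.HasAntidiagonal.antidiagonal k, a p.1 * b p.2 := by
    intro k
    have hcs : ‖PowerSeries.coeff k (e * s)‖₊ ^ 2 ≤
        (∑ p ∈ Finset.HasAntidiagonal.antidiagonal k, ‖PowerSeries.coeff p.1 e‖₊) *
        ∑ p ∈ Finset.HasAntidiagonal.antidiagonal k,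
          ‖PowerSeries.coeff p.1 e‖₊ * ‖PowerSeries.coeff p.2 s‖₊ ^ 2 := by
      have h1 : ‖PowerSeries.coeff k (e * s)‖₊ ≤ ∑ p ∈ Finset.HasAntidiagonal.antidiagonal k,
          ‖PowerSeries.coeff p.1 e‖₊ * ‖PowerSeries.coeff p.2 s‖₊ := by
        rw [PowerSeries.coeff_mul]
        exact (nnnorm_sum_le _ _).trans_eq (by simp)
      refine (pow_le_pow_left₀ zero_le h1 2).trans ?_
      exact Finset.sum_sq_le_sum_mul_sum_of_sq_le_mul _ (fun _ _ => zero_le)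
        (fun _ _ => zero_le) fun p _ => (by ring : _ = _).le
    have hcs' : (‖PowerSeries.coeff k (e * s)‖₊ : ℝ≥0∞) ^ 2 ≤
        (∑ p ∈ Finset.HasAntidiagonal.antidiagonal k, (‖PowerSeries.coeff p.1 e‖₊ : ℝ≥0∞)) *
        ∑ p ∈ Finset.HasAntidiagonal.antidiagonal k,
          (‖PowerSeries.coeff p.1 e‖₊ : ℝ≥0∞) * (‖PowerSeries.coeff p.2 s‖₊ : ℝ≥0∞) ^ 2 := by
      exact_mod_cast hcs
    have hsum : ∑ p ∈ Finset.HasAntidiagonal.antidiagonal k,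
        (‖PowerSeries.coeff p.1 e‖₊ : ℝ≥0∞) ≤ ∑' j, a j := by
      rw [Finset.Nat.sum_antidiagonal_eq_sum_range_succ_mk]
      refine le_trans (Finset.sum_le_sum fun i _ => ?_) (ENNReal.sum_le_tsum (Finset.range k.succ))
      exact le_mul_of_one_le_left zero_le (one_le_wt_abs α i)
    calc wt α k * (‖PowerSeries.coeff k (e * s)‖₊ : ℝ≥0∞) ^ 2
        ≤ wt α k * ((∑' j, a j) * ∑ p ∈ Finset.HasAntidiagonal.antidiagonal k,
          (‖PowerSeries.coeff p.1 e‖₊ : ℝ≥0∞) * (‖PowerSeries.coeff p.2 s‖₊ : ℝ≥0∞) ^ 2) := by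
          gcongr
          exact hcs'.trans (by gcongr)
      _ = (∑' j, a j) * ∑ p ∈ Finset.HasAntidiagonal.antidiagonal k, wt α k *
          ((‖PowerSeries.coeff p.1 e‖₊ : ℝ≥0∞) * (‖PowerSeries.coeff p.2 s‖₊ : ℝ≥0∞) ^ 2) := by
          rw [mul_left_comm, Finset.mul_sum]
      _ ≤ _ := by
          refine mul_le_mul_right (Finset.sum_le_sum fun p hp => ?_) _
          rw [← Finset.HasAntidiagonal.mem_antidiagonal.1 hp]
          refine (mul_le_mul_left (wt_add_le α p.1 p.2) _).trans_eq ?_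
          simp only [ha, hb]
          ring
  calc dnorm2 α (fun k => PowerSeries.coeff k (e * s))
      ≤ ∑' k, (∑' j, a j) * ∑ p ∈ Finset.HasAntidiagonal.antidiagonal k, a p.1 * b p.2 :=
        ENNReal.tsum_le_tsum key
    _ = (∑' j, a j) ^ 2 * ∑' j, b j := by
        rw [ENNReal.tsum_mul_left, tsum_sum_antidiagonal_mul]
        ring

lemma tsum_mul_nnnorm_add_sq_le {ι : Type*} (w : ι → ℝ≥0∞) (a b c : ι → ℂ) :
    ∑' i, w i * (‖a i + b i + c i‖₊ : ℝ≥0∞) ^ 2 ≤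
      3 * (∑' i, w i * (‖a i‖₊ : ℝ≥0∞) ^ 2 + ∑' i, w i * (‖b i‖₊ : ℝ≥0∞) ^ 2 +
        ∑' i, w i * (‖c i‖₊ : ℝ≥0∞) ^ 2) := by
  rw [← ENNReal.tsum_add, ← ENNReal.tsum_add, ← ENNReal.tsum_mul_left]
  refine ENNReal.tsum_le_tsum fun i => ?_
  have h : ‖a i + b i + c i‖₊ ^ 2 ≤ 3 * (‖a i‖₊ ^ 2 + ‖b i‖₊ ^ 2 + ‖c i‖₊ ^ 2) := by
    rw [← NNReal.coe_le_coe]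
    push_cast
    have h1 : ‖a i + b i + c i‖ ≤ ‖a i‖ + ‖b i‖ + ‖c i‖ := norm_add₃_le
    nlinarith [sq_nonneg (‖a i‖ - ‖b i‖), sq_nonneg (‖a i‖ - ‖c i‖), sq_nonneg (‖b i‖ - ‖c i‖),
      norm_nonneg (a i + b i + c i)]
  have h' : (‖a i + b i + c i‖₊ : ℝ≥0∞) ^ 2 ≤
      3 * ((‖a i‖₊ : ℝ≥0∞) ^ 2 + (‖b i‖₊ : ℝ≥0∞) ^ 2 + (‖c i‖₊ : ℝ≥0∞) ^ 2) := by
    exact_mod_cast h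
  refine (mul_le_mul_right h' (w i)).trans_eq ?_
  ring

lemma summable_add_one_rpow_mul_geometric (x : ℝ) {r : ℝ} (hr0 : 0 < r) (hr1 : r < 1) :
    Summable fun k : ℕ => ((k : ℝ) + 1) ^ x * r ^ k := by
  obtain ⟨N, hN⟩ := exists_nat_ge x
  have h := (summable_nat_add_iff 1).2
    (summable_pow_mul_geometric_of_norm_lt_one N (r := r) (by rwa [Real.norm_of_nonneg hr0.le]))
  refine Summable.of_nonneg_of_le (fun k => by positivity) (fun k => ?_) (h.mul_right r⁻¹)
  have h1 : ((k : ℝ) + 1) ^ x ≤ ((k : ℝ) + 1) ^ N := by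
    rw [← Real.rpow_natCast]
    exact Real.rpow_le_rpow_of_exponent_le (by linarith [(Nat.cast_nonneg k : (0 : ℝ) ≤ k)]) hN
  push_cast
  rw [pow_succ, mul_assoc, mul_assoc, mul_inv_cancel₀ hr0.ne', mul_one]
  gcongr

lemma weightSum_le_rpow (α : ℝ) (k : ℕ) : weightSum α k ≤ ((k : ℝ) + 1) ^ (|α| + 1) := by
  have hk : (0 : ℝ) ≤ k := Nat.cast_nonneg k
  calc weightSum α k ≤ ∑ _j ∈ Finset.range (k + 1), ((k : ℝ) + 1) ^ |α| := by
        refine Finset.sum_le_sum fun j hj => ?_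
        have hj : (j : ℝ) ≤ k := by exact_mod_cast Finset.mem_range_succ_iff.1 hj
        have hj0 : (0 : ℝ) ≤ j := Nat.cast_nonneg j
        exact (Real.rpow_le_rpow_of_exponent_le (by linarith) (neg_le_abs α)).trans
          (Real.rpow_le_rpow (by positivity) (by linarith) (abs_nonneg α))
    _ = _ := by
        rw [Finset.sum_const, Finset.card_range, nsmul_eq_mul, Real.rpow_add (by positivity),
          Real.rpow_one]
        push_cast
        ring


lemma conv1_eq_coeff_mul (p a : ℕ → ℂ) (k : ℕ) :
    conv1 p a k = PowerSeries.coeff k (PowerSeries.mk p * PowerSeries.mk a) := by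
  rw [PowerSeries.coeff_mul, Finset.Nat.sum_antidiagonal_eq_sum_range_succ_mk]
  simp [conv1]

lemma dnorm2_neg (α : ℝ) (s : PowerSeries ℂ) :
    dnorm2 α (fun k => PowerSeries.coeff k (-s)) = dnorm2 α fun k => PowerSeries.coeff k s := by
  simp [dnorm2]

lemma wt_mul_nnnorm_sq_le (α : ℝ) (k : ℕ) {x : ℂ} {b : ℝ} (h : ‖x‖ ≤ b) :
    wt α k * (‖x‖₊ : ℝ≥0∞) ^ 2 ≤ ENNReal.ofReal (((k : ℝ) + 1) ^ α * b ^ 2) := by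
  have hb : 0 ≤ b := (norm_nonneg x).trans h
  rw [wt_eq_ofReal, ENNReal.ofReal_mul (by positivity), ENNReal.ofReal_pow hb]
  exact mul_le_mul_right (pow_le_pow_left₀ zero_le (coe_nnnorm_le_ofReal h) 2) _

lemma dnorm2_le_div_weightSum {α C : ℝ} {m : ℕ} {s : ℕ → ℂ}
    (hs : ∀ k, ‖s k‖ ≤ C * ((k : ℝ) + 1) ^ (-α) / weightSum α m) (hs0 : ∀ k, m < k → s k = 0) :
    dnorm2 α s ≤ ENNReal.ofReal (C ^ 2 / weightSum α m) := by
  have hW := weightSum_pos α m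
  rw [dnorm2, tsum_eq_sum (s := Finset.range (m + 1)) fun k hk => by
    rw [hs0 k (by simpa using hk)]; simp]
  calc _ ≤ ∑ k ∈ Finset.range (m + 1), ENNReal.ofReal
        (((k : ℝ) + 1) ^ α * (C * ((k : ℝ) + 1) ^ (-α) / weightSum α m) ^ 2) :=
        Finset.sum_le_sum fun k _ => wt_mul_nnnorm_sq_le α k (hs k)
    _ = ENNReal.ofReal (C ^ 2 / weightSum α m) := by
        rw [← ENNReal.ofReal_sum_of_nonneg fun k _ => by positivity]
        congr 1
        have h1 : ∀ k : ℕ, ((k : ℝ) + 1) ^ α * (C * ((k : ℝ) + 1) ^ (-α) / weightSum α m) ^ 2 =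
            C ^ 2 / weightSum α m ^ 2 * ((k : ℝ) + 1) ^ (-α) := fun k => by
          have h2 : ((k : ℝ) + 1) ^ α ≠ 0 := by positivity
          rw [Real.rpow_neg (by positivity)]
          field_simp
        simp_rw [h1]
        rw [← Finset.mul_sum, ← weightSum]
        field_simp

/-- The remainder after truncating the inverse of a power series that converges on a
neighbourhood of the closed disk. -/
lemma coeff_one_sub_trunc_mul {u v : PowerSeries ℂ} (huv : u * v = 1) {C R : ℝ} (hR : 1 < R)
    (hu : ∀ k, ‖PowerSeries.coeff k u‖ ≤ C / R ^ k) (hv : ∀ k, ‖PowerSeries.coeff k v‖ ≤ C / R ^ k)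
    (m : ℕ) :
    (∀ k ≤ m, PowerSeries.coeff k (1 - (PowerSeries.trunc (m + 1) v : PowerSeries ℂ) * u) = 0) ∧
    ∀ k, ‖PowerSeries.coeff k (1 - (PowerSeries.trunc (m + 1) v : PowerSeries ℂ) * u)‖ ≤
      C ^ 2 * ((k : ℝ) + 1) * R⁻¹ ^ k := by
  have hC : 0 ≤ C := (norm_nonneg _).trans (by simpa using hu 0)
  have he : 1 - (PowerSeries.trunc (m + 1) v : PowerSeries ℂ) * u =
      (v - (PowerSeries.trunc (m + 1) v : PowerSeries ℂ)) * u := by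
    rw [sub_mul, mul_comm v u, huv]
  have hd : ∀ i, PowerSeries.coeff i (v - (PowerSeries.trunc (m + 1) v : PowerSeries ℂ)) =
      if i ≤ m then 0 else PowerSeries.coeff i v := fun i => by
    rw [map_sub, Polynomial.coeff_coe, PowerSeries.coeff_trunc]
    simp only [Nat.lt_succ_iff]
    split_ifs <;> simp
  rw [he]
  refine ⟨fun k hk => ?_, fun k => ?_⟩
  · rw [PowerSeries.coeff_mul]
    refine Finset.sum_eq_zero fun p hp => ?_
    rw [hd, if_pos (((Nat.le_add_right p.1 p.2).trans_eq
      (Finset.HasAntidiagonal.mem_antidiagonal.1 hp)).trans hk), zero_mul]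
  · rw [PowerSeries.coeff_mul]
    calc _ ≤ ∑ _p ∈ Finset.HasAntidiagonal.antidiagonal k, C ^ 2 * R⁻¹ ^ k := by
          refine norm_sum_le_of_le _ fun p hp => ?_
          have h1 : ‖PowerSeries.coeff p.1
              (v - (PowerSeries.trunc (m + 1) v : PowerSeries ℂ))‖ ≤ C / R ^ p.1 := by
            rw [hd]
            split_ifs
            · rw [norm_zero]; positivity
            · exact hv _
          rw [norm_mul, ← Finset.HasAntidiagonal.mem_antidiagonal.1 hp]
          refine (mul_le_mul h1 (hu _) (norm_nonneg _) (by positivity)).trans_eq ?_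
          rw [inv_pow, pow_add]
          field_simp
      _ = _ := by
          rw [Finset.sum_const, Finset.Nat.card_antidiagonal, nsmul_eq_mul]
          push_cast
          ring

lemma exists_tail_bound (α : ℝ) {u v : PowerSeries ℂ} (huv : u * v = 1) {C R : ℝ} (hR : 1 < R)
    (hu : ∀ k, ‖PowerSeries.coeff k u‖ ≤ C / R ^ k)
    (hv : ∀ k, ‖PowerSeries.coeff k v‖ ≤ C / R ^ k) :
    ∃ B E : ℝ, 0 ≤ B ∧ 0 ≤ E ∧ ∀ m : ℕ,
      (∑' j, wt |α| j * (‖PowerSeries.coeff j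
        (1 - (PowerSeries.trunc (m + 1) v : PowerSeries ℂ) * u)‖₊ : ℝ≥0∞)) ≤ ENNReal.ofReal B ∧
      dnorm2 α (fun k => PowerSeries.coeff k
        (1 - (PowerSeries.trunc (m + 1) v : PowerSeries ℂ) * u)) ≤
          ENNReal.ofReal (E / weightSum α m) := by
  have hR0 : 0 < R := one_pos.trans hR
  have hr0 : 0 < R⁻¹ := inv_pos.2 hR0
  have hr1 : R⁻¹ < 1 := inv_lt_one_of_one_lt₀ hR
  have hs1 := (summable_add_one_rpow_mul_geometric (|α| + 1) hr0 hr1).mul_left (C ^ 2)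
  have hs2 := (summable_add_one_rpow_mul_geometric (α + 2 + (|α| + 1)) (r := R⁻¹ ^ 2)
    (by positivity) (pow_lt_one₀ hr0.le hr1 two_ne_zero)).mul_left (C ^ 4)
  refine ⟨∑' k : ℕ, C ^ 2 * (((k : ℝ) + 1) ^ (|α| + 1) * R⁻¹ ^ k),
    ∑' k : ℕ, C ^ 4 * (((k : ℝ) + 1) ^ (α + 2 + (|α| + 1)) * (R⁻¹ ^ 2) ^ k),
    tsum_nonneg fun k => by positivity, tsum_nonneg fun k => by positivity, fun m => ⟨?_, ?_⟩⟩
  · rw [ENNReal.ofReal_tsum_of_nonneg (fun k => by positivity) hs1]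
    refine ENNReal.tsum_le_tsum fun k => ?_
    refine (mul_le_mul_right (coe_nnnorm_le_ofReal
      ((coeff_one_sub_trunc_mul huv hR hu hv m).2 k)) _).trans ?_
    rw [wt_eq_ofReal, ← ENNReal.ofReal_mul (by positivity),
      Real.rpow_add_one (by positivity : (k : ℝ) + 1 ≠ 0)]
    exact ENNReal.ofReal_le_ofReal (by ring_nf; rfl)
  · have hW := weightSum_pos α m
    rw [← tsum_div_const, ENNReal.ofReal_tsum_of_nonneg (fun k => by positivity) (hs2.div_const _)]
    refine ENNReal.tsum_le_tsum fun k => ?_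
    rcases le_or_gt k m with hk | hk
    · simp only [(coeff_one_sub_trunc_mul huv hR hu hv m).1 k hk]
      simp
    · refine (wt_mul_nnnorm_sq_le α k ((coeff_one_sub_trunc_mul huv hR hu hv m).2 k)).trans
        (ENNReal.ofReal_le_ofReal ?_)
      have hk1 : weightSum α m ≤ ((k : ℝ) + 1) ^ (|α| + 1) :=
        (weightSum_mono α hk.le).trans (weightSum_le_rpow α k)
      rw [le_div_iff₀ hW, Real.rpow_add (by positivity), Real.rpow_add (by positivity),
        Real.rpow_two]
      calc _ ≤ ((k : ℝ) + 1) ^ α * (C ^ 2 * ((k : ℝ) + 1) * R⁻¹ ^ k) ^ 2 *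
            ((k : ℝ) + 1) ^ (|α| + 1) := by gcongr
        _ = _ := by ring

/-- Upper bound for the optimal approximants in the one-variable spaces. -/
lemma exists_isPoly1_dnorm2_le (α : ℝ) {g : ℕ → ℂ}
    (hg : ∃ C R : ℝ, 1 < R ∧ ∀ k, ‖g k‖ ≤ C / R ^ k)
    (hgz : ∀ z : ℂ, ‖z‖ < 1 → (∑' k : ℕ, g k * z ^ k) ≠ 0) :
    ∃ C : ℝ, 0 < C ∧ ∀ n, ∃ p, IsPoly1 n p ∧
      dnorm2 α (fun k => conv1 p g k - one1 k) ≤ ENNReal.ofReal (C / weightSum α n) := by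
  obtain ⟨P, u, v, ⟨A, hA, hP⟩, hmk, huv, ⟨C₁, R₁, hR₁, hu⟩, ⟨C₂, R₂, hR₂, hv⟩⟩ :=
    exists_factorization α hg hgz
  have hg0 : g 0 ≠ 0 := by
    have h := hgz 0 (by simp)
    rwa [tsum_eq_single 0 fun k hk => by simp [hk], pow_zero, mul_one] at h
  have hP0 : P ≠ 0 := by
    rintro rfl
    apply hg0
    simpa using congrArg (PowerSeries.coeff 0) hmk
  have hC₁ : 0 ≤ C₁ := (norm_nonneg _).trans (by simpa using hu 0)
  have hC₂ : 0 ≤ C₂ := (norm_nonneg _).trans (by simpa using hv 0)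
  have hR : 1 < min R₁ R₂ := lt_min hR₁ hR₂
  have hR0 : 0 < min R₁ R₂ := one_pos.trans hR
  obtain ⟨B, E, hB, hE, hBE⟩ := exists_tail_bound α huv (C := max C₁ C₂) hR
    (fun k => (hu k).trans (div_le_div₀ (by positivity) (le_max_left _ _) (by positivity)
      (pow_le_pow_left₀ hR0.le (min_le_left _ _) k)))
    (fun k => (hv k).trans (div_le_div₀ (by positivity) (le_max_right _ _) (by positivity)
      (pow_le_pow_left₀ hR0.le (min_le_right _ _) k)))
  refine ⟨3 * (B ^ 2 * A ^ 2 + A ^ 2 + E) * (2 ^ |α| * 2) + 1, by positivity, fun n => ?_⟩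
  obtain ⟨q, hq, hq0⟩ := hP (n / 2)
  set m := n / 2 with hm
  have hW := weightSum_pos α m
  have hWn := weightSum_pos α n
  set T := PowerSeries.trunc (m + 1) v with hT
  set s : PowerSeries ℂ := ((1 - P * q : Polynomial ℂ) : PowerSeries ℂ) with hs
  set e : PowerSeries ℂ := 1 - (T : PowerSeries ℂ) * u with he
  refine ⟨fun k => (q * T).coeff k, fun k hk => ?_, ?_⟩
  · refine Polynomial.coeff_eq_zero_of_natDegree_lt ?_
    have hPq : (P * q).natDegree ≤ m := by
      have h1 : P * q = 1 - (1 - P * q) := by ring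
      rw [h1]
      exact (Polynomial.natDegree_sub_le _ _).trans (max_le (by simp)
        (Polynomial.natDegree_le_iff_coeff_eq_zero.2 hq0))
    have hqm : q.natDegree ≤ m := by
      rcases eq_or_ne q 0 with rfl | hq'
      · simp
      · rw [Polynomial.natDegree_mul hP0 hq'] at hPq
        omega
    have hTm : T.natDegree ≤ m := Nat.lt_succ_iff.1 (PowerSeries.natDegree_trunc_lt v m)
    have := Polynomial.natDegree_mul_le (p := q) (q := T)
    omega
  · have hcoe : PowerSeries.mk (fun k => (q * T).coeff k) = (q : PowerSeries ℂ) * T := by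
      rw [← Polynomial.coe_mul]
      ext k
      rw [PowerSeries.coeff_mk, Polynomial.coeff_coe]
    have hdec : ∀ k, conv1 (fun k => (q * T).coeff k) g k - one1 k =
        PowerSeries.coeff k (e * s) + PowerSeries.coeff k (-s) + PowerSeries.coeff k (-e) := by
      intro k
      have h1 : one1 k = PowerSeries.coeff k (1 : PowerSeries ℂ) := by
        rw [PowerSeries.coeff_one, one1]
      rw [conv1_eq_coeff_mul, hcoe, hmk, h1, ← map_sub, ← map_add, ← map_add]
      congr 1
      rw [hs, he, Polynomial.coe_sub, Polynomial.coe_mul, Polynomial.coe_one]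
      ring
    have hsn : dnorm2 α (fun k => PowerSeries.coeff k s) ≤
        ENNReal.ofReal (A ^ 2 / weightSum α m) :=
      dnorm2_le_div_weightSum (fun k => by rw [hs, Polynomial.coeff_coe]; exact hq k)
        fun k hk => by rw [hs, Polynomial.coeff_coe]; exact hq0 k hk
    have hes : dnorm2 α (fun k => PowerSeries.coeff k (e * s)) ≤
        ENNReal.ofReal (B ^ 2 * (A ^ 2 / weightSum α m)) := by
      rw [ENNReal.ofReal_mul (by positivity), ENNReal.ofReal_pow hB]
      exact (dnorm2_mul_le α e s).trans
        (mul_le_mul' (pow_le_pow_left₀ zero_le (hBE m).1 2) hsn)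
    simp_rw [hdec]
    calc dnorm2 α _ ≤ 3 * (dnorm2 α (fun k => PowerSeries.coeff k (e * s)) +
          dnorm2 α (fun k => PowerSeries.coeff k (-s)) +
          dnorm2 α (fun k => PowerSeries.coeff k (-e))) := tsum_mul_nnnorm_add_sq_le _ _ _ _
      _ ≤ ENNReal.ofReal 3 * (ENNReal.ofReal (B ^ 2 * (A ^ 2 / weightSum α m)) +
          ENNReal.ofReal (A ^ 2 / weightSum α m) + ENNReal.ofReal (E / weightSum α m)) := by
          rw [dnorm2_neg, dnorm2_neg, ENNReal.ofReal_ofNat]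
          exact mul_le_mul_right (add_le_add (add_le_add hes hsn) (hBE m).2) _
      _ = ENNReal.ofReal (3 * (B ^ 2 * A ^ 2 + A ^ 2 + E) / weightSum α m) := by
          rw [← ENNReal.ofReal_add (by positivity) (by positivity),
            ← ENNReal.ofReal_add (by positivity) (by positivity),
            ← ENNReal.ofReal_mul (by positivity)]
          congr 1
          ring
      _ ≤ _ := by
          refine ENNReal.ofReal_le_ofReal ?_
          rw [div_le_div_iff₀ hW hWn]
          have h1 := mul_le_mul_of_nonneg_left (weightSum_le_half α n)
            (by positivity : 0 ≤ 3 * (B ^ 2 * A ^ 2 + A ^ 2 + E))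
          rw [← hm] at h1
          linarith

lemma Dnorm2_mul (α : ℝ) (x y : ℕ → ℂ) :
    Dnorm2 α (fun k l => x k * y l) = dnorm2 α x * dnorm2 α y := by
  rw [Dnorm2, ENNReal.tsum_prod (f := fun k l => wt α k * wt α l * (‖x k * y l‖₊ : ℝ≥0∞) ^ 2), dnorm2, dnorm2, ← ENNReal.tsum_mul_right]
  refine tsum_congr fun k => ?_
  rw [← ENNReal.tsum_mul_left]
  refine tsum_congr fun l => ?_
  rw [nnnorm_mul, ENNReal.coe_mul]
  ring

lemma dnorm2_one1 (α : ℝ) : dnorm2 α one1 = 1 := by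
  rw [dnorm2, tsum_eq_single 0 fun k hk => by simp [one1, hk]]
  simp [one1, wt]

lemma conv2_mul (p q g h : ℕ → ℂ) (k l : ℕ) :
    conv2 (fun i j => p i * q j) (fun i j => g i * h j) k l = conv1 p g k * conv1 q h l := by
  rw [conv2, conv1, conv1, Finset.sum_mul_sum]
  exact Finset.sum_congr rfl fun i _ => Finset.sum_congr rfl fun j _ => by ring

/-- Approximate inverses of the factors multiply to an approximate inverse of a separable
function. -/
lemma Dnorm2_conv2_mul_sub_one2_le (α : ℝ) (p q g h : ℕ → ℂ) :
    Dnorm2 α (fun k l => conv2 (fun i j => p i * q j) (fun i j => g i * h j) k l - one2 k l) ≤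
      3 * (dnorm2 α (fun k => conv1 p g k - one1 k) + dnorm2 α (fun k => conv1 q h k - one1 k) +
        dnorm2 α (fun k => conv1 p g k - one1 k) * dnorm2 α (fun k => conv1 q h k - one1 k)) := by
  set a : ℕ → ℂ := fun k => conv1 p g k - one1 k with ha
  set b : ℕ → ℂ := fun k => conv1 q h k - one1 k with hb
  have hdec : ∀ k l, conv2 (fun i j => p i * q j) (fun i j => g i * h j) k l - one2 k l =
      a k * one1 l + one1 k * b l + a k * b l := fun k l => by
    have h1 : one2 k l = one1 k * one1 l := by
      simp only [one2, one1]
      split_ifs <;> simp_all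
    rw [conv2_mul, h1, ha, hb]
    ring
  simp_rw [hdec]
  refine (tsum_mul_nnnorm_add_sq_le (fun p : ℕ × ℕ => wt α p.1 * wt α p.2)
    (fun p => a p.1 * one1 p.2) (fun p => one1 p.1 * b p.2) fun p => a p.1 * b p.2).trans_eq ?_
  have h1 := Dnorm2_mul α a one1
  have h2 := Dnorm2_mul α one1 b
  have h3 := Dnorm2_mul α a b
  rw [dnorm2_one1, mul_one] at h1
  rw [dnorm2_one1, one_mul] at h2
  rw [← h3, ← h1, ← h2]
  rfl

lemma Phi_add_one_pos (α : ℝ) {n : ℕ} (hn : 1 ≤ n) : 0 < Phi α ((n : ℝ) + 1) := by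
  have hn' : (1 : ℝ) ≤ n := by exact_mod_cast hn
  rw [Phi]
  split_ifs
  · exact lt_max_of_lt_left (Real.log_pos (by linarith))
  · positivity

/-- upper bound on the rate of decay of optimal norms for separable
functions whose factors extend analytically to the closed disk with no zeros in 𝔻. -/
theorem stmt18 (α : ℝ) (hα : α ≤ 1) (g h : ℕ → ℂ)
    (hg : ∃ C R : ℝ, 1 < R ∧ ∀ k, ‖g k‖ ≤ C / R ^ k)
    (hh : ∃ C R : ℝ, 1 < R ∧ ∀ k, ‖h k‖ ≤ C / R ^ k)
    (hgz : ∀ z : ℂ, ‖z‖ < 1 → (∑' k : ℕ, g k * z ^ k) ≠ 0)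
    (hhz : ∀ z : ℂ, ‖z‖ < 1 → (∑' k : ℕ, h k * z ^ k) ≠ 0) :
    ∃ C : ℝ, 0 < C ∧ ∃ N : ℕ, ∀ n ≥ N,
      distP2 α n (fun k l => g k * h l) ≤ ENNReal.ofReal (C / Phi α ((n : ℝ) + 1)) := by
  obtain ⟨C₁, hC₁, hp⟩ := exists_isPoly1_dnorm2_le α hg hgz
  obtain ⟨C₂, hC₂, hq⟩ := exists_isPoly1_dnorm2_le α hh hhz
  refine ⟨3 * (C₁ + C₂ + C₁ * C₂) * (2 ^ |α| * 2), by positivity, 1, fun n hn => ?_⟩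
  obtain ⟨p, hpn, hp⟩ := hp n
  obtain ⟨q, hqn, hq⟩ := hq n
  have hW := weightSum_pos α n
  have hpoly : IsPoly2 n fun k l => p k * q l := by
    rintro k l (hk | hl)
    · simp [hpn k hk]
    · simp [hqn l hl]
  refine (iInf₂_le _ hpoly).trans ((Dnorm2_conv2_mul_sub_one2_le α p q g h).trans ?_)
  calc _ ≤ ENNReal.ofReal 3 * (ENNReal.ofReal (C₁ / weightSum α n) +
        ENNReal.ofReal (C₂ / weightSum α n) +
        ENNReal.ofReal C₁ * ENNReal.ofReal (C₂ / weightSum α n)) := by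
        rw [ENNReal.ofReal_ofNat]
        refine mul_le_mul_right (add_le_add (add_le_add hp hq) (mul_le_mul' (hp.trans ?_) hq)) _
        exact ENNReal.ofReal_le_ofReal (div_le_self hC₁.le (one_le_weightSum α n))
    _ = ENNReal.ofReal (3 * (C₁ + C₂ + C₁ * C₂) / weightSum α n) := by
        rw [← ENNReal.ofReal_mul hC₁.le, ← ENNReal.ofReal_add (by positivity) (by positivity),
          ← ENNReal.ofReal_add (by positivity) (by positivity),
          ← ENNReal.ofReal_mul (by positivity)]
        congr 1
        ring
    _ ≤ _ := by
        refine ENNReal.ofReal_le_ofReal ?_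
        rw [div_le_div_iff₀ hW (Phi_add_one_pos α hn)]
        have h1 := mul_le_mul_of_nonneg_left (Phi_le_weightSum α n)
          (by positivity : 0 ≤ 3 * (C₁ + C₂ + C₁ * C₂))
        linarith
end
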